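/- arXiv:2302.03119 — 3 statements merged into one kernel-verified Lean document; each statement's English description precedes it below -/
import Mathlib

section
/- Let H be the rank-16 distribution on R^24 defined as the common kernel of the eight explicit 1-forms λ^1,…,λ^8 (the E_III Pfaffian system). Then the set of smooth vector fields Y on R^24 such that [Y,X] is a section of H for every smooth section X of H is a Lie subalgebra of the Lie algebra of smooth vector fields on R^24 which, as an abstract real Lie algebra, is simple and has dimension 78 (it is the real form E_III of the exceptional Lie algebra e_6). -/
noncomputable section
open ComplexConjugate

/-- Points of `ℝ²⁴`, with coordinates `u^i = p (i-1)`, `x^i = p (7+i)`, `y^i = p (15+i)`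
for `i = 1, …, 8`. -/
abbrev Pt : Type := Fin 24 → ℝ
/-- The eight 1-forms `λ^1, …, λ^8` of the E_III Pfaffian system on `ℝ²⁴`,
evaluated at the base point `p` on the tangent vector `v`. -/
def lam (p v : Pt) : Fin 8 → ℝ :=
  ![v 0 + p 8 * v 23 + p 9 * v 19 + p 10 * v 22 + p 11 * v 17
      + p 12 * v 21 + p 13 * v 20 + p 14 * v 18 + p 15 * v 16,
    v 1 + p 8 * v 19 + p 23 * v 9 + p 21 * v 10 + p 11 * v 16
      + p 12 * v 22 + p 18 * v 13 + p 14 * v 20 + p 17 * v 15,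
    v 2 + p 8 * v 22 + p 9 * v 21 + p 23 * v 10 + p 20 * v 11
      + p 19 * v 12 + p 13 * v 17 + p 14 * v 16 + p 18 * v 15,
    v 3 + p 9 * v 8 + p 12 * v 10 + p 15 * v 11 + p 14 * v 13
      + p 17 * v 16 + p 20 * v 18 + p 23 * v 19 + p 22 * v 21,
    v 4 + p 8 * v 21 + p 22 * v 9 + p 10 * v 19 + p 11 * v 18
      + p 23 * v 12 + p 13 * v 16 + p 17 * v 14 + p 20 * v 15,
    v 5 + p 12 * v 8 + p 10 * v 9 + p 11 * v 14 + p 15 * v 13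
      + p 20 * v 16 + p 18 * v 17 + p 19 * v 22 + p 23 * v 21,
    v 6 + p 10 * v 8 + p 9 * v 12 + p 13 * v 11 + p 15 * v 14
      + p 18 * v 16 + p 17 * v 20 + p 21 * v 19 + p 23 * v 22,
    v 7 + p 8 * v 16 + p 9 * v 17 + p 10 * v 18 + p 11 * v 19
      + p 12 * v 20 + p 13 * v 21 + p 14 * v 22 + p 15 * v 23]
/-- The Lie bracket of vector fields on `ℝ²⁴`, identified with maps `ℝ²⁴ → ℝ²⁴`
via the standard trivialization of the tangent bundle. -/
def vfBracket (X Y : Pt → Pt) : Pt → Pt :=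
  fun p => fderiv ℝ Y p (X p) - fderiv ℝ X p (Y p)

/-- `X` is a smooth section of the rank-16 distribution `H` annihilated by the
eight 1-forms `λ^i`. -/
def IsSectionH (X : Pt → Pt) : Prop :=
  ContDiff ℝ (⊤ : ℕ∞) X ∧ ∀ p : Pt, ∀ i : Fin 8, lam p (X p) i = 0

/-- The set of infinitesimal symmetries of the distribution `H`: smooth vector fields
`Y` such that `[Y, X]` is again a section of `H` for every smooth section `X` of `H`. -/
def symH : Set (Pt → Pt) :=
  {Y | ContDiff ℝ (⊤ : ℕ∞) Y ∧
    ∀ X : Pt → Pt, IsSectionH X → ∀ p : Pt, ∀ i : Fin 8, lam p (vfBracket Y X p) i = 0}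

/-- The coordinate paired with the `a`-th horizontal coordinate in the 1-form `λ^i`. -/
def partner : Fin 8 → Fin 16 → Fin 16 :=
  ![![15, 11, 14, 9, 13, 12, 10, 8, 7, 3, 6, 1, 5, 4, 2, 0],
    ![11, 15, 13, 8, 14, 10, 12, 9, 3, 7, 5, 0, 6, 2, 4, 1],
    ![14, 13, 15, 12, 11, 9, 8, 10, 6, 5, 7, 4, 3, 1, 0, 2],
    ![1, 0, 4, 7, 2, 6, 5, 3, 9, 8, 12, 15, 10, 14, 13, 11],
    ![13, 14, 11, 10, 15, 8, 9, 12, 5, 6, 3, 2, 7, 0, 1, 4],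
    ![4, 2, 1, 6, 0, 7, 3, 5, 12, 10, 9, 14, 8, 15, 11, 13],
    ![2, 4, 0, 5, 1, 3, 7, 6, 10, 12, 8, 13, 9, 11, 15, 14],
    ![8, 9, 10, 11, 12, 13, 14, 15, 0, 1, 2, 3, 4, 5, 6, 7]]

/-- `coef i a` is `1` if `a` is the undifferentiated member of its pair in `λ^i`. -/
def coef : Fin 8 → Fin 16 → ℤ :=
  ![![1, 1, 1, 1, 1, 1, 1, 1, 0, 0, 0, 0, 0, 0, 0, 0],
    ![1, 0, 0, 1, 1, 0, 1, 0, 0, 1, 1, 0, 0, 1, 0, 1],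
    ![1, 1, 0, 0, 0, 1, 1, 0, 0, 0, 1, 1, 1, 0, 0, 1],
    ![0, 1, 0, 0, 1, 0, 1, 1, 0, 1, 0, 0, 1, 0, 1, 1],
    ![1, 0, 1, 1, 0, 1, 0, 0, 0, 1, 0, 0, 1, 0, 1, 1],
    ![0, 0, 1, 1, 1, 0, 0, 1, 0, 0, 1, 1, 1, 0, 0, 1],
    ![0, 1, 1, 0, 0, 1, 0, 1, 0, 1, 1, 0, 0, 1, 0, 1],
    ![1, 1, 1, 1, 1, 1, 1, 1, 0, 0, 0, 0, 0, 0, 0, 0]]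

def sgn (i : Fin 8) (a : Fin 16) : ℤ := 2 * coef i a - 1

theorem partner_partner : ∀ i a, partner i (partner i a) = a := by decide +kernel

theorem partner_comm : ∀ i j a, partner i (partner j a) = partner j (partner i a) := by
  decide +kernel

theorem partner_injective : ∀ i j a, partner i a = partner j a → i = j := by decide +kernel

theorem sgn_mul_self : ∀ i a, sgn i a * sgn i a = 1 := by decide +kernel

theorem sgn_partner : ∀ i a, sgn i (partner i a) = -sgn i a := by decide +kernel

def eta (i j : Fin 8) : ℤ := if i = 7 ∨ j = 7 then 1 else -1

theorem sgn_clifford : ∀ i j a, i ≠ j →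
    sgn i a * sgn j a * sgn i (partner j a) * sgn j (partner i a) = eta i j := by
  decide +kernel

theorem exists_partner_cycle_three : ∀ a, ∃ i j k,
    partner k (partner j (partner i a)) = a := by
  decide +kernel

theorem exists_partner_cycle_three_sgn : ∀ k c, ∃ i j,
    sgn i c * sgn k (partner i c) *
      (sgn j (partner k (partner i c)) * sgn i (partner j (partner k (partner i c)))) *
      (sgn k (partner k (partner j c)) * sgn j (partner k (partner k (partner j c)))) = 1 := by
  decide +kernel

theorem exists_partner_cycle_four_sgn : ∀ a b, b ≠ partner 7 a → a ≠ b → ∃ i j k l,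
    partner l (partner k (partner j (partner i a))) = a ∧
    partner l (partner k (partner j (partner i b))) = b ∧
    sgn i a * sgn i b * (sgn j (partner i a) * sgn j (partner i b)) *
      (sgn k (partner j (partner i a)) * sgn k (partner j (partner i b))) *
      (sgn l (partner k (partner j (partner i a))) *
        sgn l (partner k (partner j (partner i b)))) = -1 := by
  decide +kernel

theorem eta_mul_eta_mul_eta : ∀ i j k, i ≠ j → i ≠ k → j ≠ k →
    eta k j * eta j i * eta k i = -1 := by
  decide +kernel

theorem eta_mul_self : ∀ i j, eta i j * eta i j = 1 := by decide +kernel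

theorem exists_partner_cycle_four_zero : ∀ a, ∃ i j k l,
    partner i (partner j (partner k (partner l a))) = 0 := by
  decide +kernel

theorem Derivation.map_intCast_mul {A : Type*} [CommRing A] [Algebra ℝ A] (D : Derivation ℝ A A)
    (n : ℤ) (g : A) : D (n * g) = n * D g := by
  rw [← zsmul_eq_mul, map_zsmul, zsmul_eq_mul]

section Ring

variable {R : Type*} [CommRing R]

theorem cast_sgn_mul_self (i : Fin 8) (a : Fin 16) : (sgn i a : R) * sgn i a = 1 := by
  exact_mod_cast congrArg (Int.cast (R := R)) (sgn_mul_self i a)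

theorem cast_sgn_partner (i : Fin 8) (a : Fin 16) : (sgn i (partner i a) : R) = -sgn i a := by
  exact_mod_cast congrArg (Int.cast (R := R)) (sgn_partner i a)

theorem cast_sgn_clifford {i j : Fin 8} (h : i ≠ j) (a : Fin 16) :
    (sgn i a : R) * sgn j a * sgn i (partner j a) * sgn j (partner i a) = eta i j := by
  exact_mod_cast congrArg (Int.cast (R := R)) (sgn_clifford i j a h)

theorem sgn_mul_cancel {i : Fin 8} {a : Fin 16} {g h : R} (e : sgn i a * g = sgn i a * h) :
    g = h := by
  linear_combination (sgn i a : R) * e - (g - h) * cast_sgn_mul_self (R := R) i a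

theorem two_mul_clifford_elim {p q p' q' a b c e r s : R}
    (e₁ : p * a - p' * b = q * r) (e₂ : q * c - q' * b = p * s)
    (e₃ : -p * e - -p' * c = q' * r) (e₄ : -q * e - -q' * a = p' * s)
    (hp : p * p = 1) (hq : q * q = 1) (hp' : p' * p' = 1) (hq' : q' * q' = 1) :
    2 * (r - p * q * p' * q' * s) = 0 := by
  have h₁ : p * p' * b + p * q * r = q * q' * e + p' * q' * s := by
    linear_combination q' * e₄ - p * e₁ + a * (hp - hq')
  have h₂ : q * q' * b + p * q * s = p * p' * e + p' * q' * r := by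
    linear_combination p' * e₃ - q * e₂ + c * (hq - hp')
  have h₃ : b + p' * q * r = p * p' * q * q' * e + p * q' * s := by
    linear_combination p * p' * h₁ - (p' * p' * b + p' * q * r) * hp + (p * q' * s - b) * hp'
  have h₄ : b + p * q' * s = p * p' * q * q' * e + p' * q * r := by
    linear_combination q * q' * h₂ - (p * q' * s + b * q' * q') * hq + (p' * q * r - b) * hq'
  linear_combination p' * q * (h₃ - h₄) - 2 * r * q * q * hp' - 2 * r * hq

end Ring

/-- Derivations `X a`, `U i` of a commutative algebra satisfying the structure equations of the
`H`-type group of the Pfaffian system, together with coordinate functions and evaluation at the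
origin. -/
structure HFrame (A : Type*) [CommRing A] [Algebra ℝ A] where
  X : Fin 16 → Derivation ℝ A A
  U : Fin 8 → Derivation ℝ A A
  z : Fin 16 → A
  w : Fin 8 → A
  ev : A →ₐ[ℝ] ℝ
  X_partner : ∀ i a g, X (partner i a) (X a g) - X a (X (partner i a) g) = sgn i a * U i g
  X_comm : ∀ a b g, (∀ i, partner i a ≠ b) → X a (X b g) = X b (X a g)
  X_U : ∀ a i g, X a (U i g) = U i (X a g)
  U_comm : ∀ i j g, U i (U j g) = U j (U i g)
  X_z : ∀ a b, X a (z b) = if a = b then 1 else 0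
  U_z : ∀ i b, U i (z b) = 0
  X_w : ∀ a i, 2 * X a (w i) = sgn i a * z (partner i a)
  U_w : ∀ i j, U i (w j) = if i = j then 1 else 0
  ev_z : ∀ a, ev (z a) = 0
  ev_w : ∀ i, ev (w i) = 0
  eq_of_X_eq_zero : ∀ g, (∀ a, X a g = 0) → (∀ i, U i g = 0) → g = algebraMap ℝ A (ev g)

namespace HFrame

variable {A : Type*} [CommRing A] [Algebra ℝ A]

theorem eq_of_two_mul {g h : A} (e : 2 * (g - h) = 0) : g = h := by
  have h2 : (2 : ℝ) • (g - h) = 0 := by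
    rw [two_smul, ← two_mul, e]
  exact sub_eq_zero.mp ((smul_eq_zero.mp h2).resolve_left two_ne_zero)

theorem eq_zero_of_eq_neg {g : A} (h : g = -g) : g = 0 :=
  eq_of_two_mul (by linear_combination h)

variable (F : HFrame A)

theorem X_X_comm {g : A} (hg : ∀ i, F.U i g = 0) (a b : Fin 16) :
    F.X a (F.X b g) = F.X b (F.X a g) := by
  by_cases h : ∃ i, partner i a = b
  · obtain ⟨i, rfl⟩ := h
    have := F.X_partner i a g
    rw [hg, mul_zero, sub_eq_zero] at this
    exact this.symm
  · exact F.X_comm a b g (by simpa using h)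

theorem U_eq_zero {g : A} (hg : ∀ a, F.X a g = 0) (i : Fin 8) : F.U i g = 0 := by
  have := F.X_partner i 0 g
  simp only [hg, map_zero, sub_zero] at this
  exact sgn_mul_cancel (i := i) (a := 0) (by rw [← this, mul_zero])

theorem eq_algebraMap {g : A} (hg : ∀ a, F.X a g = 0) : g = algebraMap ℝ A (F.ev g) :=
  F.eq_of_X_eq_zero g hg (F.U_eq_zero hg)

theorem eq_zero_of_ev {g : A} (hg : ∀ a, F.X a g = 0) (h : F.ev g = 0) : g = 0 := by
  rw [F.eq_algebraMap hg, h, map_zero]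

/-- The structure equations satisfied by the components of an infinitesimal symmetry. -/
def IsSol (f : Fin 8 → A) (y : Fin 16 → A) : Prop :=
  ∀ i a, F.X a (f i) = sgn i a * y (partner i a)

namespace IsSol

variable {F} {f : Fin 8 → A} {y : Fin 16 → A}

theorem map_U (h : F.IsSol f y) (k : Fin 8) :
    F.IsSol (fun i => F.U k (f i)) (fun a => F.U k (y a)) := fun i a => by
  simp only [F.X_U, h i a, Derivation.map_intCast_mul]

theorem sgn_mul_X (h : F.IsSol f y) (i j : Fin 8) (a : Fin 16) :
    sgn i a * F.X (partner j a) (y (partner i a)) -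
      sgn i (partner j a) * F.X a (y (partner i (partner j a))) = sgn j a * F.U j (f i) := by
  rw [← F.X_partner, h, h]
  simp only [Derivation.map_intCast_mul]

theorem U_eq_eta_mul_U (h : F.IsSol f y) {i j : Fin 8} (hij : i ≠ j) :
    F.U j (f i) = eta i j * F.U i (f j) := by
  have c : partner j (partner i 0) = partner i (partner j 0) := partner_comm j i 0
  have e₁ := h.sgn_mul_X i j 0
  have e₂ := h.sgn_mul_X j i 0
  have e₃ := h.sgn_mul_X i j (partner i 0)
  have e₄ := h.sgn_mul_X j i (partner j 0)
  simp only [c] at e₂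
  simp only [c, partner_partner] at e₃
  simp only [← c, partner_partner] at e₄
  simp only [cast_sgn_partner] at e₃ e₄
  simp only [c] at e₄
  rw [← cast_sgn_clifford hij 0]
  refine eq_of_two_mul ?_
  linear_combination two_mul_clifford_elim e₁ e₂ e₃ e₄ (cast_sgn_mul_self _ _)
    (cast_sgn_mul_self _ _) (cast_sgn_mul_self _ _) (cast_sgn_mul_self _ _)

theorem X_self_add (h : F.IsSol f y) (i : Fin 8) (a : Fin 16) :
    F.X a (y a) + F.X (partner i a) (y (partner i a)) = F.U i (f i) := by
  have := h.sgn_mul_X i i a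
  rw [partner_partner, cast_sgn_partner] at this
  exact sgn_mul_cancel (i := i) (a := a) (by linear_combination this)

theorem U_self_eq (h : F.IsSol f y) (i j : Fin 8) : F.U i (f i) = F.U j (f j) := by
  have e₁ := h.X_self_add i 0
  have e₂ := h.X_self_add i (partner j 0)
  have e₃ := h.X_self_add j 0
  have e₄ := h.X_self_add j (partner i 0)
  rw [partner_comm j i] at e₄
  exact eq_of_two_mul (by linear_combination e₃ + e₄ - e₁ - e₂)

theorem U_y (h : F.IsSol f y) (i : Fin 8) (c : Fin 16) :
    F.U i (y (partner i c)) = sgn i c * F.X c (F.U 7 (f 7)) := by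
  have := F.X_U c i (f i)
  rw [h.U_self_eq i 7, h i c, Derivation.map_intCast_mul] at this
  rw [this, ← mul_assoc, cast_sgn_mul_self, one_mul]

theorem U_X_U_eq (h : F.IsSol f y) (i k : Fin 8) (c : Fin 16) :
    F.U k (F.X c (F.U 7 (f 7))) = -(sgn i c * sgn k (partner i c) *
      F.U i (F.X (partner k (partner i c)) (F.U 7 (f 7)))) := by
  have e₁ := congrArg (F.U k) (h.U_y i c)
  have e₂ := congrArg (F.U i) (h.U_y k (partner k (partner i c)))
  rw [partner_partner, F.U_comm] at e₂
  simp only [Derivation.map_intCast_mul, cast_sgn_partner, neg_mul, map_neg] at e₁ e₂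
  refine sgn_mul_cancel (i := i) (a := c) ?_
  linear_combination e₂ - e₁ + sgn k (partner i c) *
    F.U i (F.X (partner k (partner i c)) (F.U 7 (f 7))) * cast_sgn_mul_self (R := A) i c

theorem U_X_U_eq_zero (h : F.IsSol f y) (k : Fin 8) (c : Fin 16) :
    F.U k (F.X c (F.U 7 (f 7))) = 0 := by
  obtain ⟨i, j, hs⟩ := exists_partner_cycle_three_sgn k c
  have e₁ := h.U_X_U_eq i k c
  have e₂ := h.U_X_U_eq j i (partner k (partner i c))
  have e₃ := h.U_X_U_eq k j (partner k (partner j c))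
  have p : partner i (partner j (partner k (partner i c))) = partner k (partner j c) := by
    rw [partner_comm k i, partner_comm j i, partner_partner, partner_comm]
  rw [partner_partner, partner_partner] at e₃
  rw [p] at e₂
  have hs' := congrArg (Int.cast (R := A)) hs
  push_cast [partner_partner] at hs'
  rw [e₂, e₃] at e₁
  refine eq_zero_of_eq_neg ?_
  linear_combination e₁ - F.U k (F.X c (F.U 7 (f 7))) * hs'

theorem U_U_y (h : F.IsSol f y) (i j : Fin 8) (b : Fin 16) : F.U i (F.U j (y b)) = 0 := by
  have e := h.U_y j (partner j b)
  rw [partner_partner] at e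
  rw [e, Derivation.map_intCast_mul, h.U_X_U_eq_zero, mul_zero]

theorem X_U_U (h : F.IsSol f y) (a : Fin 16) (i j k : Fin 8) :
    F.X a (F.U i (F.U j (f k))) = 0 := by
  rw [F.X_U, F.X_U, h k a, Derivation.map_intCast_mul, Derivation.map_intCast_mul, h.U_U_y,
    mul_zero]

theorem U_U_eq_zero (h : F.IsSol f y) (hr : ∀ i, F.U i (F.U 7 (f 7)) = 0) (i j k : Fin 8) :
    F.U i (F.U j (f k)) = 0 := by
  have flip : ∀ i j k, j ≠ k → F.U i (F.U j (f k)) = eta k j * F.U i (F.U k (f j)) :=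
    fun i j k hjk => by rw [h.U_eq_eta_mul_U hjk.symm, Derivation.map_intCast_mul]
  have diag : ∀ i j, F.U i (F.U j (f j)) = 0 := fun i j => by rw [h.U_self_eq j 7, hr]
  rcases eq_or_ne j k with rfl | hjk
  · exact diag i j
  rcases eq_or_ne i k with rfl | hik
  · rw [F.U_comm]; exact diag j i
  rcases eq_or_ne i j with rfl | hij
  · rw [flip i i k hik, F.U_comm, diag, mul_zero]
  have e₁ := flip i j k hjk
  have e₂ := flip j i k hik
  have e₃ := flip k i j hij
  rw [F.U_comm j i] at e₂
  rw [F.U_comm k i, F.U_comm k j] at e₃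
  have s₁ := congrArg (Int.cast (R := A)) (eta_mul_eta_mul_eta i j k hij hik hjk)
  have s₂ := congrArg (Int.cast (R := A)) (eta_mul_self k i)
  push_cast at s₁ s₂
  refine eq_zero_of_eq_neg ?_
  linear_combination e₁ + eta k j * e₃ - eta k j * eta j i * eta k i * e₂ +
    F.U i (F.U j (f k)) * s₁ - eta k j * eta j i * F.U j (F.U k (f i)) * s₂

/-- If all `U j (f i)` vanish, the matrix `X a (y b)` commutes with the Clifford action. -/
theorem X_y_eq (h : F.IsSol f y) (hU : ∀ i j, F.U j (f i) = 0) (i : Fin 8) (a b : Fin 16) :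
    F.X a (y b) = -(sgn i a * sgn i b * F.X (partner i b) (y (partner i a))) := by
  have e := F.X_X_comm (fun j => hU i j) a (partner i b)
  rw [h, h, partner_partner] at e
  simp only [Derivation.map_intCast_mul, cast_sgn_partner, neg_mul, map_neg] at e
  refine sgn_mul_cancel (i := i) (a := b) ?_
  linear_combination -e + sgn i a * F.X (partner i b) (y (partner i a)) * cast_sgn_mul_self (R := A) i b

theorem X_y_eq_zero (h : F.IsSol f y) (hU : ∀ i j, F.U j (f i) = 0) {a b : Fin 16}
    (hab : b ≠ partner 7 a) : F.X a (y b) = 0 := by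
  rcases eq_or_ne a b with rfl | hne
  · obtain ⟨i, j, k, hc⟩ := exists_partner_cycle_three a
    have step : ∀ i c, F.X c (y c) = -F.X (partner i c) (y (partner i c)) := fun i c => by
      rw [h.X_y_eq hU i c c, cast_sgn_mul_self, one_mul]
    refine eq_zero_of_eq_neg ?_
    conv_lhs => rw [step i, step j, step k, hc]
    rw [neg_neg]
  · obtain ⟨i, j, k, l, ha, hb, hs⟩ := exists_partner_cycle_four_sgn a b hab hne
    have hs' := congrArg (Int.cast (R := A)) hs
    push_cast at hs'
    have e₁ := h.X_y_eq hU i a b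
    have e₂ := h.X_y_eq hU j (partner i b) (partner i a)
    have e₃ := h.X_y_eq hU k (partner j (partner i a)) (partner j (partner i b))
    have e₄ := h.X_y_eq hU l (partner k (partner j (partner i b)))
      (partner k (partner j (partner i a)))
    rw [ha, hb] at e₄
    rw [e₂, e₃, e₄] at e₁
    refine eq_zero_of_eq_neg ?_
    linear_combination e₁ + F.X a (y b) * hs'

theorem X_X_y_eq_zero (h : F.IsSol f y) (hU : ∀ i j, F.U j (f i) = 0) (a b c : Fin 16) :
    F.X c (F.X a (y b)) = 0 := by
  by_cases hb : b = partner 7 a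
  · subst hb
    have comm : ∀ d : Fin 16, d ≠ c → F.X c (F.X d (y (partner 7 d))) = 0 := fun d hd => by
      have hU7 : ∀ i, F.U i (y (partner 7 d)) = 0 := fun i => by
        have := h.U_y i (partner i (partner 7 d))
        rwa [partner_partner, hU, map_zero, mul_zero] at this
      rw [F.X_X_comm hU7, h.X_y_eq_zero hU fun e => hd (by
        simpa only [partner_partner] using congrArg (partner 7) e), map_zero]
    rcases eq_or_ne a c with rfl | hac
    · have e := h.X_y_eq hU 0 a (partner 7 a)
      have := comm (partner 0 (partner 7 a)) fun e' => by
        have := congrArg (partner 0) e'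
        rw [partner_partner] at this
        exact absurd (partner_injective _ _ _ this) (by decide)
      rw [partner_comm 7, partner_partner] at this
      rw [e, map_neg, mul_assoc, Derivation.map_intCast_mul, Derivation.map_intCast_mul, this]
      simp
    · exact comm a hac
  · rw [h.X_y_eq_zero hU hb, map_zero]

end IsSol
end HFrame

namespace HFrame

variable {A : Type*} [CommRing A] [Algebra ℝ A] {F : HFrame A}

namespace IsSol

variable {f : Fin 8 → A} {y : Fin 16 → A}

theorem X_U_U_self_eq_zero (h : F.IsSol f y) (hr : ∀ i, F.ev (F.U i (F.U 7 (f 7))) = 0)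
    (a c : Fin 16) : F.X a (F.X c (F.U 7 (f 7))) = 0 := by
  have hUU := h.U_U_eq_zero fun i => F.eq_zero_of_ev (fun a => h.X_U_U a i 7 7) (hr i)
  obtain ⟨i, hi⟩ : ∃ i, partner i c ≠ partner 7 a := by
    by_contra! hc
    exact absurd (partner_injective 0 1 c ((hc 0).trans (hc 1).symm)) (by decide)
  have e := (h.map_U i).X_y_eq_zero (fun j k => hUU k i j) hi
  rw [h.U_y, Derivation.map_intCast_mul] at e
  exact sgn_mul_cancel (i := i) (a := c) (by rw [e, mul_zero])

theorem U_eq_zero_of_ev (h : F.IsSol f y) (hr : ∀ i, F.ev (F.U i (F.U 7 (f 7))) = 0)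
    (hq : ∀ c, F.ev (F.X c (F.U 7 (f 7))) = 0) (hk : F.ev (F.U 7 (f 7)) = 0)
    (hA : ∀ i j, i < j → F.ev (F.U j (f i)) = 0) (i j : Fin 8) : F.U j (f i) = 0 := by
  have hX : ∀ c, F.X c (F.U 7 (f 7)) = 0 := fun c =>
    F.eq_zero_of_ev (fun a => h.X_U_U_self_eq_zero hr a c) (hq c)
  have hUy : ∀ i b, F.U i (y b) = 0 := fun i b => by
    have := h.U_y i (partner i b)
    rwa [partner_partner, hX, mul_zero] at this
  refine F.eq_zero_of_ev (fun a => ?_) ?_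
  · rw [F.X_U, h, Derivation.map_intCast_mul, hUy, mul_zero]
  · rcases lt_trichotomy i j with hij | rfl | hij
    · exact hA i j hij
    · rw [h.U_self_eq i 7, hk]
    · rw [h.U_eq_eta_mul_U hij.ne', map_mul, hA j i hij, mul_zero]

theorem X_y_partner_eq_zero (h : F.IsSol f y) (hU : ∀ i j, F.U j (f i) = 0)
    (h0 : F.X 0 (y (partner 7 0)) = 0) (a : Fin 16) : F.X a (y (partner 7 a)) = 0 := by
  have step : ∀ i a, F.X (partner i (partner 7 a)) (y (partner 7 (partner i (partner 7 a)))) = 0 →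
      F.X a (y (partner 7 a)) = 0 := fun i a e => by
    rw [partner_comm 7, partner_partner] at e
    rw [h.X_y_eq hU i, e, mul_zero, neg_zero]
  obtain ⟨i, j, k, l, e⟩ := exists_partner_cycle_four_zero a
  refine step l _ (step k _ (step j _ (step i _ ?_)))
  rwa [partner_comm 7 l, partner_partner, partner_comm 7 j, partner_partner, e]

/-- A symmetry is determined by finitely many derivatives at the origin. -/
theorem eq_zero_of_ev (h : F.IsSol f y) (hr : ∀ i, F.ev (F.U i (F.U 7 (f 7))) = 0)
    (hq : ∀ c, F.ev (F.X c (F.U 7 (f 7))) = 0) (hk : F.ev (F.U 7 (f 7)) = 0)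
    (hA : ∀ i j, i < j → F.ev (F.U j (f i)) = 0) (ht : F.ev (F.X 0 (F.X 0 (f 7))) = 0)
    (hy : ∀ c, F.ev (F.X c (f 7)) = 0) (hf : ∀ i, F.ev (f i) = 0) : f = 0 := by
  have hU := h.U_eq_zero_of_ev hr hq hk hA
  have hXX0 : F.X 0 (F.X 0 (f 7)) = 0 := by
    refine F.eq_zero_of_ev (fun a => ?_) ht
    rw [h, Derivation.map_intCast_mul, Derivation.map_intCast_mul, h.X_X_y_eq_zero hU, mul_zero]
  have hXy0 : F.X 0 (y (partner 7 0)) = 0 := by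
    rw [h, Derivation.map_intCast_mul] at hXX0
    exact sgn_mul_cancel (i := 7) (a := 0) (by rw [hXX0, mul_zero])
  have hXy : ∀ a b, F.X a (y b) = 0 := fun a b => by
    by_cases hb : b = partner 7 a
    · rw [hb, h.X_y_partner_eq_zero hU hXy0]
    · exact h.X_y_eq_zero hU hb
  have hX7 : ∀ c, F.X c (f 7) = 0 := fun c =>
    F.eq_zero_of_ev (fun a => by rw [h, Derivation.map_intCast_mul, hXy, mul_zero]) (hy c)
  have hy0 : ∀ b, y b = 0 := fun b => by
    have e := hX7 (partner 7 b)
    rw [h, partner_partner] at e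
    exact sgn_mul_cancel (i := 7) (a := partner 7 b) (by rw [e, mul_zero])
  funext i
  exact F.eq_zero_of_ev (fun a => by rw [h, hy0, mul_zero]) (hf i)

end IsSol

section Jet

open Module

/-- The pairs `i < j` in `Fin 8`. -/
abbrev OrderedPair : Type := {p : Fin 8 × Fin 8 // p.1 < p.2}

variable (F)

def jetUU : (Fin 8 → A) →ₗ[ℝ] (Fin 8 → ℝ) :=
  .pi fun i => F.ev.toLinearMap ∘ₗ (F.U i).toLinearMap ∘ₗ (F.U 7).toLinearMap ∘ₗ .proj 7

def jetXU : (Fin 8 → A) →ₗ[ℝ] (Fin 16 → ℝ) :=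
  .pi fun c => F.ev.toLinearMap ∘ₗ (F.X c).toLinearMap ∘ₗ (F.U 7).toLinearMap ∘ₗ .proj 7

def jetDiag : (Fin 8 → A) →ₗ[ℝ] (Fin 1 → ℝ) :=
  .pi fun _ => F.ev.toLinearMap ∘ₗ (F.U 7).toLinearMap ∘ₗ .proj 7

def jetU : (Fin 8 → A) →ₗ[ℝ] (OrderedPair → ℝ) :=
  .pi fun p => F.ev.toLinearMap ∘ₗ (F.U p.1.2).toLinearMap ∘ₗ .proj p.1.1

def jetXX : (Fin 8 → A) →ₗ[ℝ] (Fin 1 → ℝ) :=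
  .pi fun _ => F.ev.toLinearMap ∘ₗ (F.X 0).toLinearMap ∘ₗ (F.X 0).toLinearMap ∘ₗ .proj 7

def jetX : (Fin 8 → A) →ₗ[ℝ] (Fin 16 → ℝ) :=
  .pi fun c => F.ev.toLinearMap ∘ₗ (F.X c).toLinearMap ∘ₗ .proj 7

def jetVal : (Fin 8 → A) →ₗ[ℝ] (Fin 8 → ℝ) :=
  .pi fun i => F.ev.toLinearMap ∘ₗ .proj i

abbrev JetSpace : Type :=
  ((((((Fin 8 → ℝ) × (Fin 16 → ℝ)) × (Fin 1 → ℝ)) × (OrderedPair → ℝ)) × (Fin 1 → ℝ)) ×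
    (Fin 16 → ℝ)) × (Fin 8 → ℝ)

theorem finrank_jetSpace : finrank ℝ JetSpace = 78 := by
  have : Fintype.card OrderedPair = 28 := by decide +kernel
  simp only [finrank_prod, finrank_fintype_fun_eq_card, Fintype.card_fin, this]

/-- The derivatives at the origin which determine a symmetry. -/
def jet : (Fin 8 → A) →ₗ[ℝ] JetSpace :=
  (((((F.jetUU.prod F.jetXU).prod F.jetDiag).prod F.jetU).prod F.jetXX).prod F.jetX).prod F.jetVal

variable {F}

theorem IsSol.eq_zero_of_jet {f : Fin 8 → A} {y : Fin 16 → A} (h : F.IsSol f y)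
    (hj : F.jet f = 0) : f = 0 := by
  have hr : F.jetUU f = 0 := congrArg (·.1.1.1.1.1.1) hj
  have hq : F.jetXU f = 0 := congrArg (·.1.1.1.1.1.2) hj
  have hk : F.jetDiag f = 0 := congrArg (·.1.1.1.1.2) hj
  have hA : F.jetU f = 0 := congrArg (·.1.1.1.2) hj
  have ht : F.jetXX f = 0 := congrArg (·.1.1.2) hj
  have hy : F.jetX f = 0 := congrArg (·.1.2) hj
  have hf : F.jetVal f = 0 := congrArg (·.2) hj
  exact h.eq_zero_of_ev (congrFun hr) (congrFun hq) (congrFun hk 0)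
    (fun i j hij => congrFun hA ⟨(i, j), hij⟩) (congrFun ht 0) (congrFun hy) (congrFun hf)

end Jet

end HFrame

section Surjective

variable {V M ι : Type*} [AddCommGroup V] [Module ℝ V] [AddCommGroup M] [Module ℝ M]
  {G : Submodule ℝ V}

theorem Submodule.exists_mem_prod_eq {L : V →ₗ[ℝ] M} {T : V →ₗ[ℝ] (ι → ℝ)} [Fintype ι]
    [DecidableEq ι] (hL : ∀ m, ∃ g ∈ G, L g = m)
    (hT : ∀ i, ∃ g ∈ G, L g = 0 ∧ ∃ c : ℝ, c ≠ 0 ∧ T g = Pi.single i c) (m : M × (ι → ℝ)) :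
    ∃ g ∈ G, L.prod T g = m := by
  obtain ⟨g₀, hg₀, e₀⟩ := hL m.1
  choose g hg hgL c hc hgT using hT
  refine ⟨g₀ + ∑ i, ((m.2 - T g₀) i / c i) • g i,
    G.add_mem hg₀ (G.sum_mem fun i _ => G.smul_mem _ (hg i)), ?_⟩
  refine Prod.ext ?_ ?_
  · simp [hgL, e₀]
  · ext j
    simp [hgT, Finset.sum_apply, Pi.single_apply, hc]

end Surjective

section Fierz

/-- A term `c * z x * z y` of a quadratic form. -/
abbrev QuadTerm : Type := ℤ × Fin 16 × Fin 16

namespace QuadTerm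

/-- Add a term to a list of terms, collecting like monomials. -/
def insert (c : ℤ) (x y : Fin 16) : List QuadTerm → List QuadTerm
  | [] => [(c, x, y)]
  | (d, x', y') :: l =>
    if (x = x' ∧ y = y') ∨ (x = y' ∧ y = x') then
      if c + d = 0 then l else (c + d, x', y') :: l
    else (d, x', y') :: insert c x y l

def collect : List QuadTerm → List QuadTerm
  | [] => []
  | (c, x, y) :: l => if c = 0 then collect l else insert c x y (collect l)

variable {R : Type*} [CommRing R]

def eval (z : Fin 16 → R) : List QuadTerm → R
  | [] => 0
  | (c, x, y) :: l => c * (z x * z y) + eval z l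

theorem eval_insert (z : Fin 16 → R) (c : ℤ) (x y : Fin 16) (l : List QuadTerm) :
    eval z (insert c x y l) = c * (z x * z y) + eval z l := by
  induction l with
  | nil => rfl
  | cons t l ih =>
    obtain ⟨d, x', y'⟩ := t
    have key : (x = x' ∧ y = y') ∨ (x = y' ∧ y = x') → z x * z y = z x' * z y' := by
      rintro (⟨rfl, rfl⟩ | ⟨rfl, rfl⟩)
      · rfl
      · ring
    unfold insert
    split_ifs with h h'
    · have e : (c : R) + d = 0 := by exact_mod_cast congrArg (Int.cast (R := R)) h'
      simp only [eval, key h]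
      linear_combination -(z x' * z y') * e
    · simp only [eval, key h, Int.cast_add]
      ring
    · simp only [eval, ih]
      ring

theorem eval_collect (z : Fin 16 → R) (l : List QuadTerm) : eval z (collect l) = eval z l := by
  induction l with
  | nil => rfl
  | cons t l ih =>
    obtain ⟨c, x, y⟩ := t
    unfold collect
    split_ifs with h
    · simp [eval, h, ih]
    · rw [eval_insert, ih, eval]

theorem eval_append (z : Fin 16 → R) (l m : List QuadTerm) :
    eval z (l ++ m) = eval z l + eval z m := by
  induction l with
  | nil => simp [eval]
  | cons t l ih => simp only [List.cons_append, eval, ih]; ring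

theorem eval_flatMap (z : Fin 16 → R) {ι : Type*} (s : List ι) (l : ι → List QuadTerm) :
    eval z (s.flatMap l) = (s.map fun i => eval z (l i)).sum := by
  induction s with
  | nil => simp [eval]
  | cons i s ih => simp [eval_append, ih]

end QuadTerm

def coefK (i : Fin 8) (a : Fin 16) : ℤ := sgn i a * sgn 7 (partner i a)

def coefH (i j : Fin 8) (a : Fin 16) : ℤ :=
  if j = i ∨ j = 7 then 0 else sgn i a * sgn j (partner i a) * sgn 7 (partner j (partner i a))

def coefL (i j : Fin 8) (a : Fin 16) : ℤ :=
  if j = i ∨ j = 7 then 0 else coefK i a * coefK j (partner 7 (partner i a))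

def half : Fin 16 → Bool :=
  ![false, false, false, true, false, true, true, true,
    true, true, true, false, true, false, false, false]

theorem half_partner : ∀ j b, j ≠ 7 → half (partner j (partner 7 b)) = !half b := by
  decide +kernel

theorem half_partner_partner : ∀ i j b, i ≠ 7 → j ≠ i → j ≠ 7 →
    half (partner i (partner j (partner 7 b))) = !half b := by
  decide +kernel

def fierzTerms (i : Fin 8) (a b : Fin 16) : List QuadTerm :=
  (List.finRange 8).flatMap fun j =>
    [(coefL i j a * coefK j b, partner j (partner i a), partner j (partner 7 b)),
      (-(sgn j a * coefH i j b), partner j a, partner i (partner j (partner 7 b)))]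

theorem collect_fierzTerms : ∀ i a b, i ≠ 7 → half b ≠ half a →
    QuadTerm.collect (fierzTerms i a b) = [] := by
  decide +kernel

theorem coefK_partner : ∀ j b, coefK j (partner j (partner 7 b)) = coefK j b := by
  decide +kernel

theorem coefH_partner : ∀ i j b, i ≠ 7 →
    coefH i j (partner i (partner j (partner 7 b))) = coefH i j b := by
  decide +kernel

variable {R : Type*} [CommRing R] (z : Fin 16 → R)

def formK (j : Fin 8) : R := ∑ b, coefK j b * (z b * z (partner j (partner 7 b)))

def formH (i j : Fin 8) : R := ∑ b, coefH i j b * (z b * z (partner i (partner j (partner 7 b))))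

theorem sum_eq_two_mul_sum_half (a : Fin 16) (τ : Fin 16 → Fin 16) (hτ : Function.Involutive τ)
    (hh : ∀ b, half (τ b) = !half b) (G : Fin 16 → R) (hG : ∀ b, G (τ b) = G b) :
    ∑ b, G b = 2 * ∑ b, if half b ≠ half a then G b else 0 := by
  have e : ∑ b, (if half b ≠ half a then G b else 0) = ∑ b, if half b = half a then G b else 0 := by
    rw [← Equiv.sum_comp hτ.toPerm]
    refine Finset.sum_congr rfl fun b _ => ?_
    simp only [Function.Involutive.coe_toPerm, hG, hh]
    cases half b <;> cases half a <;> simp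
  rw [two_mul]
  nth_rw 1 [e]
  rw [← Finset.sum_add_distrib]
  refine Finset.sum_congr rfl fun b _ => ?_
  split_ifs <;> simp_all

theorem eval_fierzTerms (i : Fin 8) (a b : Fin 16) :
    QuadTerm.eval z (fierzTerms i a b) =
      ∑ j, (coefL i j a * coefK j b * (z (partner j (partner i a)) * z (partner j (partner 7 b))) -
        sgn j a * coefH i j b * (z (partner j a) * z (partner i (partner j (partner 7 b))))) := by
  rw [fierzTerms, QuadTerm.eval_flatMap, Fin.sum_univ_def]
  refine congrArg List.sum (List.map_congr_left fun j _ => ?_)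
  simp only [QuadTerm.eval]
  push_cast
  ring

theorem fierz {i : Fin 8} (hi : i ≠ 7) (a : Fin 16) :
    ∑ j, (coefL i j a * formK z j * z (partner j (partner i a)) -
      sgn j a * z (partner j a) * formH z i j) = 0 := by
  have key : ∀ j, coefL i j a * formK z j * z (partner j (partner i a)) -
      sgn j a * z (partner j a) * formH z i j = 2 * ∑ b, if half b ≠ half a then
        z b * (coefL i j a * coefK j b *
            (z (partner j (partner i a)) * z (partner j (partner 7 b))) -
          sgn j a * coefH i j b *
            (z (partner j a) * z (partner i (partner j (partner 7 b))))) else 0 := by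
    intro j
    by_cases hj : j = i ∨ j = 7
    · simp [coefL, formH, coefH, hj]
    · push Not at hj
      have inv₁ : Function.Involutive fun b => partner j (partner 7 b) := fun b => by
        simp only [partner_comm 7 j, partner_partner]
      have inv₂ : Function.Involutive fun b => partner i (partner j (partner 7 b)) := fun b => by
        simp only [partner_comm 7, partner_comm j i, partner_partner]
      have e₁ := sum_eq_two_mul_sum_half a _ inv₁ (fun b => half_partner j b hj.2)
        (fun b => (coefK j b : R) * (z b * z (partner j (partner 7 b)))) fun b => by
          simp only [coefK_partner, inv₁ b]
          ring
      have e₂ := sum_eq_two_mul_sum_half a _ inv₂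
        (fun b => half_partner_partner i j b hi hj.1 hj.2)
        (fun b => (coefH i j b : R) * (z b * z (partner i (partner j (partner 7 b))))) fun b => by
          simp only [coefH_partner i j b hi, inv₂ b]
          ring
      rw [formK, formH, e₁, e₂]
      simp only [Finset.mul_sum, Finset.sum_mul, ← Finset.sum_sub_distrib]
      refine Finset.sum_congr rfl fun b _ => ?_
      split_ifs <;> ring
  simp only [key, ← Finset.mul_sum]
  rw [Finset.sum_comm, Finset.sum_eq_zero, mul_zero]
  intro b _
  split_ifs with h
  · rw [← Finset.mul_sum, ← eval_fierzTerms, ← QuadTerm.eval_collect, collect_fierzTerms i a b hi h,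
      QuadTerm.eval, mul_zero]
  · simp

end Fierz

namespace Derivation

variable {A : Type*} [CommRing A] [Algebra ℝ A]

theorem map_ofNat (D : Derivation ℝ A A) (n : ℕ) [n.AtLeastTwo] : D (ofNat(n) : A) = 0 :=
  D.map_natCast n

end Derivation

namespace HFrame

variable {A : Type*} [CommRing A] [Algebra ℝ A] (F : HFrame A)

section Forms

theorem X_sum_involutive (a : Fin 16) {τ : Fin 16 → Fin 16} (hτ : Function.Involutive τ)
    (c : Fin 16 → ℤ) (hc : ∀ b, c (τ b) = c b) :
    F.X a (∑ b, c b * (F.z b * F.z (τ b))) = 2 * (c a * F.z (τ a)) := by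
  have e : ∀ b, (a = τ b) = (τ a = b) := fun b => propext (by rw [← hτ.eq_iff, eq_comm])
  simp only [map_sum, Derivation.map_intCast, Derivation.leibniz, F.X_z, smul_eq_mul, e, mul_add,
    Finset.sum_add_distrib, mul_ite, mul_one, mul_zero, Finset.sum_ite_eq, Finset.mem_univ, if_true,
    hc, add_zero]
  ring

theorem U_sum_quadratic (i : Fin 8) (τ : Fin 16 → Fin 16) (c : Fin 16 → ℤ) :
    F.U i (∑ b, c b * (F.z b * F.z (τ b))) = 0 := by
  simp [Derivation.map_intCast, F.U_z]

theorem X_formK (a : Fin 16) (j : Fin 8) :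
    F.X a (formK F.z j) = 2 * (coefK j a * F.z (partner j (partner 7 a))) :=
  F.X_sum_involutive a (fun b => by simp only [partner_comm 7 j, partner_partner]) _
    (coefK_partner j)

theorem X_formH (a : Fin 16) {i : Fin 8} (hi : i ≠ 7) (j : Fin 8) :
    F.X a (formH F.z i j) = 2 * (coefH i j a * F.z (partner i (partner j (partner 7 a)))) := by
  by_cases hj : j = i ∨ j = 7
  · simp [formH, coefH, hj]
  · exact F.X_sum_involutive a
      (fun b => by simp only [partner_comm 7, partner_comm j i, partner_partner]) _
      fun b => coefH_partner i j b hi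

theorem U_formK (i j : Fin 8) : F.U i (formK F.z j) = 0 := F.U_sum_quadratic i _ _

theorem U_formH (k i j : Fin 8) : F.U k (formH F.z i j) = 0 := F.U_sum_quadratic k _ _

end Forms

/-- The candidate for the horizontal part of a symmetry, recovered from its last component. -/
def yOf (f : Fin 8 → A) (b : Fin 16) : A := -(sgn 7 b * F.X (partner 7 b) (f 7))

theorem IsSol.yOf_eq {F : HFrame A} {f : Fin 8 → A} {y : Fin 16 → A} (h : F.IsSol f y) :
    F.yOf f = y := by
  funext b
  rw [yOf, h, partner_partner, cast_sgn_partner]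
  linear_combination y b * cast_sgn_mul_self (R := A) 7 b

/-- The space of solutions of the symmetry equations. -/
def sol : Submodule ℝ (Fin 8 → A) where
  carrier := {f | F.IsSol f (F.yOf f)}
  add_mem' {f g} hf hg i a := by
    simp only [Pi.add_apply, map_add, hf i a, hg i a, yOf]
    ring
  zero_mem' i a := by simp [yOf]
  smul_mem' c f hf i a := by
    simp only [Pi.smul_apply, Derivation.map_smul, hf i a, yOf, mul_smul_comm, smul_neg, mul_neg]

theorem mem_sol {f : Fin 8 → A} : f ∈ F.sol ↔ F.IsSol f (F.yOf f) := Iff.rfl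

theorem IsSol.mem_sol {F : HFrame A} {f : Fin 8 → A} {y : Fin 16 → A} (h : F.IsSol f y) :
    f ∈ F.sol := by
  rw [F.mem_sol, h.yOf_eq]
  exact h

/-- The constant solutions. -/
def solConst (c : Fin 8 → ℝ) (k : Fin 8) : A := algebraMap ℝ A (c k)

theorem isSol_solConst (c : Fin 8 → ℝ) : F.IsSol (solConst c) 0 := fun i a => by
  simp [solConst]

/-- The linear solutions. -/
def solR (a : Fin 16) (k : Fin 8) : A := -(sgn k a * F.z (partner k a))

theorem isSol_solR (a : Fin 16) : F.IsSol (F.solR a) (Pi.single a 1) := fun i c => by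
  have e : (c = partner i a) = (partner i c = a) := propext ⟨fun h => by
    rw [h, partner_partner], fun h => by rw [← h, partner_partner]⟩
  simp only [solR, map_neg, Derivation.map_intCast_mul, F.X_z, Pi.single_apply, e]
  split_ifs with h
  · rw [← h, cast_sgn_partner]
    ring
  · simp

/-- The solution given by the grading element. -/
def solE (k : Fin 8) : A := 2 * F.w k

theorem isSol_solE : F.IsSol F.solE F.z := fun i a => by
  rw [← F.X_w, solE, Derivation.leibniz]
  simp [Derivation.map_ofNat]

theorem linear_coef : ∀ i j a, i ≠ 7 →
    (if j = i then sgn 7 a else 0) + (if j = 7 then sgn i a else 0) - coefH i j a +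
      coefK i a * sgn j (partner 7 (partner i a)) = 0 := by
  decide +kernel

theorem cubic_coef : ∀ i j a, i ≠ 7 →
    (if j = i then coefK 7 a else 0) + (if j = 7 then coefK i a else 0) +
      coefK i a * coefK j (partner 7 (partner i a)) = coefL i j a := by
  decide +kernel

def solZ (i : Fin 8) : A :=
  if i = 7 then 16 * ∑ j, F.w j * F.w j + ∑ j, formK F.z j * formK F.z j
  else 32 * (F.w 7 * F.w i) + 2 * (formK F.z 7 * formK F.z i) - 8 * ∑ j, F.w j * formH F.z i j

theorem X_solZ_last (a : Fin 16) :
    F.X a (F.solZ 7) = 16 * ∑ j, F.w j * (sgn j a * F.z (partner j a)) +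
      4 * ∑ j, coefK j a * (formK F.z j * F.z (partner j (partner 7 a))) := by
  simp only [solZ, if_true, map_add, map_sum, Derivation.leibniz, Derivation.map_ofNat,
    smul_eq_mul, X_formK,
    ← F.X_w, Finset.mul_sum]
  congr 1 <;> exact Finset.sum_congr rfl fun j _ => by ring

theorem X_solZ {i : Fin 8} (hi : i ≠ 7) (a : Fin 16) :
    F.X a (F.solZ i) = 16 * (F.w 7 * (sgn i a * F.z (partner i a)) +
        F.w i * (sgn 7 a * F.z (partner 7 a))) +
      4 * (formK F.z 7 * (coefK i a * F.z (partner i (partner 7 a))) +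
        formK F.z i * (coefK 7 a * F.z a)) -
      (16 * ∑ j, F.w j * (coefH i j a * F.z (partner i (partner j (partner 7 a)))) +
        4 * ∑ j, sgn j a * F.z (partner j a) * formH F.z i j) := by
  have e : F.z a = F.z (partner 7 (partner 7 a)) := by rw [partner_partner]
  simp only [solZ, if_neg hi, map_add, map_sub, map_sum, Derivation.leibniz, Derivation.map_ofNat,
    smul_eq_mul, X_formK, F.X_formH a hi, ← F.X_w, Finset.sum_add_distrib]
  rw [e]
  simp only [mul_zero, add_zero, Finset.mul_sum]
  congr 1
  · ring
  · rw [mul_add, Finset.mul_sum, Finset.mul_sum]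
    congr 1 <;> exact Finset.sum_congr rfl fun j _ => by ring

theorem isSol_solZ : F.IsSol F.solZ (F.yOf F.solZ) := fun i a => by
  by_cases hi : i = 7
  · subst hi
    rw [yOf, partner_partner, cast_sgn_partner]
    linear_combination -F.X a (F.solZ 7) * cast_sgn_mul_self (R := A) 7 a
  · have hF := fierz F.z hi a
    have h₁ : ∑ j, F.w j * ((((if j = i then sgn 7 a else 0) + (if j = 7 then sgn i a else 0) -
        coefH i j a + coefK i a * sgn j (partner 7 (partner i a)) : ℤ) : A) *
          F.z (partner i (partner j (partner 7 a)))) = 0 :=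
      Finset.sum_eq_zero fun j _ => by rw [linear_coef i j a hi]; simp
    have hL : ∀ j, (coefL i j a : A) = _ := fun j =>
      congrArg Int.cast (cubic_coef i j a hi).symm
    have p : ∀ j, partner j (partner 7 (partner i a)) = partner i (partner j (partner 7 a)) :=
      fun j => by rw [partner_comm 7 i, partner_comm j i]
    rw [F.X_solZ hi, yOf, X_solZ_last]
    simp only [p, partner_partner]
    simp only [hL] at hF
    push_cast at h₁ hF
    simp only [add_mul, mul_add, sub_mul, mul_sub, Finset.sum_add_distrib, Finset.sum_sub_distrib,
      ite_mul, mul_ite, zero_mul, mul_zero, Finset.sum_ite_eq', Finset.mem_univ, if_true,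
      partner_partner, mul_assoc, mul_left_comm _ (coefK i a : A), ← Finset.mul_sum] at h₁ hF ⊢
    simp only [partner_comm 7 i] at h₁ hF ⊢
    have hK : (sgn i a : A) * sgn 7 (partner i a) = coefK i a := by simp [coefK]
    rw [← hK] at h₁ hF ⊢
    linear_combination 16 * h₁ + 4 * hF

end HFrame

theorem partner_involutive (i : Fin 8) : Function.Involutive (partner i) := partner_partner i

namespace HFrame

variable {A : Type*} [CommRing A] [Algebra ℝ A] (F : HFrame A)

/-- The derivation `∑ f j * U j + ∑ yOf f a * X a` attached to a tuple of functions. -/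
def act (f : Fin 8 → A) (h : A) : A := ∑ j, f j * F.U j h + ∑ a, F.yOf f a * F.X a h

/-- The bracket of vector fields in terms of their vertical components. -/
def br (f g : Fin 8 → A) (k : Fin 8) : A :=
  ∑ a, sgn k a * (F.yOf f a * F.yOf g (partner k a)) +
    ∑ j, (f j * F.U j (g k) - g j * F.U j (f k))

theorem br_comm (f g : Fin 8 → A) : F.br f g = -F.br g f := by
  funext k
  have e : ∑ a, (sgn k a : A) * (F.yOf f a * F.yOf g (partner k a)) =
      -∑ a, sgn k a * (F.yOf g a * F.yOf f (partner k a)) := by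
    rw [← Equiv.sum_comp (partner_involutive k).toPerm,
      ← Finset.sum_neg_distrib]
    refine Finset.sum_congr rfl fun a _ => ?_
    simp only [Function.Involutive.coe_toPerm, partner_partner, cast_sgn_partner]
    ring
  simp only [br, Pi.neg_apply, e, neg_add, ← Finset.sum_neg_distrib]
  congr 1
  exact Finset.sum_congr rfl fun j _ => by ring

theorem sum_mul_comm_X (y : Fin 16 → A) (c : Fin 16) (g : A) :
    ∑ a, y a * (F.X a (F.X c g) - F.X c (F.X a g)) =
      ∑ j, y (partner j c) * (sgn j c * F.U j g) := by
  have inj : Function.Injective fun j => partner j c := fun i j h => partner_injective i j c h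
  simp only [← F.X_partner]
  rw [← Finset.sum_image (s := Finset.univ) (g := fun j => partner j c)
    (f := fun a => y a * (F.X a (F.X c g) - F.X c (F.X a g))) (fun i _ j _ h => inj h)]
  refine (Finset.sum_subset (Finset.subset_univ _) fun a _ ha => ?_).symm
  rw [F.X_comm a c, sub_self, mul_zero]
  intro i hi
  exact ha (Finset.mem_image.mpr ⟨i, Finset.mem_univ i, by
    rw [← hi, partner_partner]⟩)

variable {F}

theorem act_of_isSol {f g : Fin 8 → A} {y : Fin 16 → A} (hg : F.IsSol g y) (k : Fin 8) :
    F.act f (g k) =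
      ∑ j, f j * F.U j (g k) + ∑ a, sgn k a * (F.yOf f a * y (partner k a)) := by
  simp only [act, hg k, mul_left_comm]

theorem sum_comm_X_of_isSol {g : Fin 8 → A} {x : Fin 16 → A} (hg : F.IsSol g x)
    (y : Fin 16 → A) (k : Fin 8) (c : Fin 16) :
    ∑ a, sgn k a * (y a * F.X c (x (partner k a))) =
      sgn k c * ∑ a, y a * F.X a (x (partner k c)) -
        ∑ j, y (partner j c) * (sgn j c * F.U j (g k)) := by
  rw [← F.sum_mul_comm_X, Finset.mul_sum, ← Finset.sum_sub_distrib]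
  refine Finset.sum_congr rfl fun a _ => ?_
  rw [hg, hg, Derivation.map_intCast_mul, Derivation.map_intCast_mul]
  ring

theorem isSol_br {f g : Fin 8 → A} (hf : f ∈ F.sol) (hg : g ∈ F.sol) :
    F.IsSol (F.br f g) fun b => F.act f (F.yOf g b) - F.act g (F.yOf f b) := fun k c => by
  rw [mem_sol] at hf hg
  have e₁ := sum_comm_X_of_isSol hg (F.yOf f) k c
  have e₂ := sum_comm_X_of_isSol hf (F.yOf g) k c
  have e₃ : ∑ a, sgn k a * (F.yOf g (partner k a) * F.X c (F.yOf f a)) =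
      -∑ a, sgn k a * (F.yOf g a * F.X c (F.yOf f (partner k a))) := by
    rw [← Equiv.sum_comp (partner_involutive k).toPerm,
      ← Finset.sum_neg_distrib]
    refine Finset.sum_congr rfl fun a _ => ?_
    simp only [Function.Involutive.coe_toPerm, partner_partner, cast_sgn_partner]
    ring
  have h₁ : F.X c (F.br f g k) =
      ∑ a, sgn k a * (F.yOf f a * F.X c (F.yOf g (partner k a))) +
      ∑ a, sgn k a * (F.yOf g (partner k a) * F.X c (F.yOf f a)) +
      (sgn k c * ∑ j, f j * F.U j (F.yOf g (partner k c)) +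
        ∑ j, F.yOf f (partner j c) * (sgn j c * F.U j (g k)) -
      (sgn k c * ∑ j, g j * F.U j (F.yOf f (partner k c)) +
        ∑ j, F.yOf g (partner j c) * (sgn j c * F.U j (f k)))) := by
    simp only [br, map_add, map_sum, map_sub, Derivation.leibniz, smul_eq_mul,
      Derivation.map_intCast, F.X_U, hf k c, hg k c, hf _ c, hg _ c, Finset.mul_sum,
      ← Finset.sum_add_distrib, ← Finset.sum_sub_distrib]
    congr 1 <;> refine Finset.sum_congr rfl fun j _ => by ring
  rw [h₁, e₁, e₃, e₂]
  simp only [act]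
  ring

theorem br_mem_sol {f g : Fin 8 → A} (hf : f ∈ F.sol) (hg : g ∈ F.sol) : F.br f g ∈ F.sol :=
  (isSol_br hf hg).mem_sol

variable (F)

theorem br_solConst (f : Fin 8 → A) (c : Fin 8 → ℝ) :
    F.br f (solConst c) = -∑ j, c j • fun k => F.U j (f k) := by
  funext k
  simp only [br, (F.isSol_solConst c).yOf_eq]
  simp [solConst, Algebra.smul_def]

/-- The operator by which the linear solution `solR a` acts on solutions. -/
def opR (a : Fin 16) (h : A) : A := F.X a h - ∑ j, sgn j a * (F.z (partner j a) * F.U j h)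

theorem br_solR {f : Fin 8 → A} (hf : f ∈ F.sol) (a : Fin 16) :
    F.br f (F.solR a) = -fun k => F.opR a (f k) := by
  funext k
  have e : ∀ b, (partner k b = a) = (b = partner k a) := fun b => propext ⟨fun h => by
    rw [← h, partner_partner], fun h => by rw [h, partner_partner]⟩
  rw [mem_sol] at hf
  simp only [br, (F.isSol_solR a).yOf_eq, Pi.single_apply, e, opR, Pi.neg_apply, hf k a]
  simp [solR, F.U_z, cast_sgn_partner, mul_assoc]
  ring

theorem opR_of_U {h : A} (hU : ∀ j, F.U j h = 0) (a : Fin 16) : F.opR a h = F.X a h := by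
  simp [opR, hU]

theorem ev_opR (a : Fin 16) (h : A) : F.ev (F.opR a h) = F.ev (F.X a h) := by
  simp [opR, F.ev_z]

theorem U_opR (i : Fin 8) (a : Fin 16) (h : A) : F.U i (F.opR a h) = F.opR a (F.U i h) := by
  simp only [opR, map_sub, map_sum, Derivation.map_intCast, Derivation.leibniz, F.U_z,
    mul_zero, add_zero, F.X_U, smul_eq_mul, F.U_comm i]

theorem X_opR (c a : Fin 16) (h : A) : F.X c (F.opR a h) = F.opR a (F.X c h) := by
  have e₁ := F.sum_mul_comm_X (Pi.single c 1) a h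
  simp only [Pi.single_apply, ite_mul, one_mul, zero_mul, Finset.sum_ite_eq', Finset.mem_univ,
    if_true] at e₁
  have e₂ : ∀ j, F.X c (F.U j h) = F.U j (F.X c h) := fun j => F.X_U c j h
  simp only [opR, map_sub, map_sum, Derivation.map_intCast, Derivation.leibniz, F.X_z,
    smul_eq_mul, mul_zero, add_zero, e₂, mul_add, Finset.sum_add_distrib]
  have e₃ : ∑ j, (sgn j a : A) * (F.U j h * if c = partner j a then 1 else 0) =
      ∑ j, if partner j a = c then sgn j a * F.U j h else 0 :=
    Finset.sum_congr rfl fun j _ => by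
      simp only [eq_comm (a := c)]
      split_ifs <;> simp
  rw [e₃, ← e₁]
  ring

theorem U_br (i : Fin 8) (f g : Fin 8 → A) :
    (fun k => F.U i (F.br f g k)) =
      F.br (fun k => F.U i (f k)) g + F.br f (fun k => F.U i (g k)) := by
  funext k
  have e : ∀ f : Fin 8 → A, ∀ b, F.U i (F.yOf f b) = F.yOf (fun k => F.U i (f k)) b := fun f b => by
    simp only [yOf, map_neg, Derivation.map_intCast_mul, F.X_U]
  simp only [br, Pi.add_apply, map_add, map_sum, map_sub, Derivation.map_intCast,
    Derivation.leibniz, smul_eq_mul, e, F.U_comm i, mul_zero, add_zero]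
  rw [add_add_add_comm, ← Finset.sum_add_distrib, ← Finset.sum_add_distrib]
  congr 1 <;> refine Finset.sum_congr rfl fun j _ => by ring

end HFrame

namespace HFrame

variable {A : Type*} [CommRing A] [Algebra ℝ A] (F : HFrame A)

theorem U_solZ_last (j : Fin 8) : F.U j (F.solZ 7) = 32 * F.w j := by
  have e : ∑ i, F.w i * F.U j (F.w i) = F.w j := by simp [F.U_w]
  have : F.U j (F.solZ 7) = 32 * ∑ i, F.w i * F.U j (F.w i) := by
    simp only [solZ, if_true, map_add, map_sum, Derivation.leibniz, Derivation.map_ofNat,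
      smul_eq_mul, U_formK, mul_zero, add_zero, Finset.sum_const_zero, Finset.mul_sum]
    exact Finset.sum_congr rfl fun i _ => by ring
  rw [this, e]

theorem U_solZ {i : Fin 8} (hi : i ≠ 7) (j : Fin 8) :
    F.U j (F.solZ i) = 32 * ((if j = 7 then F.w i else 0) + (if j = i then F.w 7 else 0)) -
      8 * formH F.z i j := by
  simp only [solZ, if_neg hi, map_add, map_sub, map_sum, Derivation.leibniz, Derivation.map_ofNat,
    smul_eq_mul, U_formK, U_formH, F.U_w, mul_zero, add_zero, zero_add, mul_ite, mul_one,
    Finset.sum_ite_eq, Finset.mem_univ, if_true]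
  split_ifs <;> ring

/-- The structure constants of the product on `ℝ⁸` for which `7` is a unit and which is otherwise
valued in the line spanned by `7`. -/
def coefU (i j k : Fin 8) : ℤ :=
  if k = 7 then (if i = j then 1 else 0)
  else (if i = 7 ∧ j = k then 1 else 0) + (if j = 7 ∧ i = k then 1 else 0)

theorem U_U_solZ (i j : Fin 8) :
    (fun k => F.U i (F.U j (F.solZ k))) = solConst fun k => 32 * coefU i j k := by
  funext k
  by_cases hk : k = 7
  · subst hk
    simp [solConst, U_solZ_last, coefU, Derivation.map_ofNat, F.U_w, apply_ite (algebraMap ℝ A),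
      map_ofNat (algebraMap ℝ A)]
  · rw [F.U_solZ hk]
    simp only [solConst, coefU, hk, if_false, map_sub, map_add, Derivation.leibniz,
      Derivation.map_ofNat, smul_eq_mul, U_formH, mul_zero, add_zero, sub_zero]
    split_ifs <;> simp_all [F.U_w, map_ofNat (algebraMap ℝ A)]

omit [Algebra ℝ A] in
theorem formH_last (z : Fin 16 → A) (i : Fin 8) : formH z i 7 = 0 := by
  simp [formH, coefH]

theorem U_last_solZ : (fun k => F.U 7 (F.solZ k)) = (16 : ℝ) • F.solE := by
  funext k
  by_cases hk : k = 7
  · subst hk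
    simp only [U_solZ_last, Pi.smul_apply, solE, Algebra.smul_def, map_ofNat]
    ring
  · rw [F.U_solZ hk]
    simp only [formH_last, Pi.smul_apply, solE, Algebra.smul_def, map_ofNat, if_true, Ne.symm hk,
      if_false]
    ring

theorem opR_solE (a : Fin 16) : (fun k => F.opR a (F.solE k)) = F.solR a := by
  funext k
  have e := F.isSol_solE k a
  simp only [opR, e]
  simp [solE, solR, Derivation.map_ofNat, F.U_w]
  ring

section Ideal

variable {F} {I : Submodule ℝ (Fin 8 → A)} (hle : I ≤ F.sol)
  (hI : ∀ f ∈ F.sol, ∀ g ∈ I, F.br f g ∈ I)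

include hI in
theorem br_mem_of_left {f g : Fin 8 → A} (hf : f ∈ I) (hg : g ∈ F.sol) : F.br f g ∈ I := by
  rw [br_comm]
  exact I.neg_mem (hI g hg f hf)

include hI in
theorem U_mem_ideal {f : Fin 8 → A} (hf : f ∈ I) (i : Fin 8) : (fun k => F.U i (f k)) ∈ I := by
  have h := br_mem_of_left hI hf (F.isSol_solConst (Pi.single i 1)).mem_sol
  rw [F.br_solConst, Finset.sum_eq_single i (fun j _ hj => by simp [hj]) (by simp)] at h
  simpa using h

include hle hI in
theorem opR_mem_ideal {f : Fin 8 → A} (hf : f ∈ I) (a : Fin 16) :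
    (fun k => F.opR a (f k)) ∈ I := by
  have h := br_mem_of_left hI hf (F.isSol_solR a).mem_sol
  rwa [F.br_solR (hle hf), neg_mem_iff] at h

theorem exists_solConst_of_X_eq_zero {f : Fin 8 → A} (hf : f ∈ I) (h0 : f ≠ 0)
    (hX : ∀ a k, F.X a (f k) = 0) : ∃ c : Fin 8 → ℝ, c ≠ 0 ∧ solConst c ∈ I := by
  have e : solConst (fun k => F.ev (f k)) = f :=
    funext fun k => (F.eq_algebraMap fun a => hX a k).symm
  refine ⟨fun k => F.ev (f k), fun h => h0 ?_, by rwa [e]⟩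
  rw [← e, h]
  exact funext fun k => map_zero _

include hle hI in
theorem exists_solConst_of_U_eq_zero {f : Fin 8 → A} (hf : f ∈ I) (h0 : f ≠ 0)
    (hU : ∀ j k, F.U j (f k) = 0) : ∃ c : Fin 8 → ℝ, c ≠ 0 ∧ solConst c ∈ I := by
  have hs := hle hf
  rw [mem_sol] at hs
  have hX : ∀ b, (fun k => F.X b (f k)) ∈ I := fun b => by
    simpa only [F.opR_of_U fun j => hU j _] using opR_mem_ideal hle hI hf b
  have hUX : ∀ b j k, F.U j (F.X b (f k)) = 0 := fun b j k => by rw [← F.X_U, hU, map_zero]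
  have hXX : ∀ a b, (fun k => F.X a (F.X b (f k))) ∈ I := fun a b => by
    simpa only [F.opR_of_U fun j => hUX b j _] using opR_mem_ideal hle hI (hX b) a
  by_cases h₂ : ∃ a b, (fun k => F.X a (F.X b (f k))) ≠ 0
  · obtain ⟨a, b, h₂⟩ := h₂
    refine exists_solConst_of_X_eq_zero (F := F) (hXX a b) h₂ fun c k => ?_
    rw [hs, Derivation.map_intCast_mul, Derivation.map_intCast_mul,
      hs.X_X_y_eq_zero fun i j => hU j i, mul_zero]
  push Not at h₂
  by_cases h₁ : ∃ b, (fun k => F.X b (f k)) ≠ 0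
  · obtain ⟨b, h₁⟩ := h₁
    exact exists_solConst_of_X_eq_zero (F := F) (hX b) h₁ fun a k => congrFun (h₂ a b) k
  push Not at h₁
  exact exists_solConst_of_X_eq_zero (F := F) hf h0 fun a k => congrFun (h₁ a) k

include hle hI in
theorem exists_solConst_mem {f : Fin 8 → A} (hf : f ∈ I) (h0 : f ≠ 0) :
    ∃ c : Fin 8 → ℝ, c ≠ 0 ∧ solConst c ∈ I := by
  have hs := hle hf
  rw [mem_sol] at hs
  by_cases h₂ : ∃ i j, (fun k => F.U i (F.U j (f k))) ≠ 0
  · obtain ⟨i, j, h₂⟩ := h₂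
    exact exists_solConst_of_X_eq_zero (F := F) (U_mem_ideal hI (U_mem_ideal hI hf j) i) h₂ fun a k =>
      hs.X_U_U a i j k
  push Not at h₂
  by_cases h₁ : ∃ j, (fun k => F.U j (f k)) ≠ 0
  · obtain ⟨j, h₁⟩ := h₁
    exact exists_solConst_of_U_eq_zero hle hI (U_mem_ideal hI hf j) h₁ fun i k =>
      congrFun (h₂ i j) k
  push Not at h₁
  exact exists_solConst_of_U_eq_zero hle hI hf h0 fun j k => congrFun (h₁ j) k

theorem solConst_smul (r : ℝ) (c : Fin 8 → ℝ) : solConst (r • c) = (r • solConst c : _ → A) :=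
  funext fun k => by simp [solConst, Algebra.smul_def]

theorem solConst_mem_of_smul {r : ℝ} (hr : r ≠ 0) {c : Fin 8 → ℝ}
    (h : solConst (r • c) ∈ I) : solConst c ∈ I := by
  rw [solConst_smul] at h
  exact (I.smul_mem_iff hr).mp h

include hI in
theorem solConst_mem_step {c : Fin 8 → ℝ} (hc : solConst c ∈ I) {d : Fin 8} (hd : d ≠ 7) :
    solConst (Pi.single d (c 7) + Pi.single 7 (c d)) ∈ I := by
  have h := hI _ F.isSol_solZ.mem_sol _ hc
  rw [F.br_solConst, neg_mem_iff] at h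
  have h' := U_mem_ideal hI h d
  refine solConst_mem_of_smul (r := 32) (by norm_num) ?_
  convert h' using 1
  funext k
  have e : ∀ j, F.U d (F.U j (F.solZ k)) = algebraMap ℝ A (32 * coefU d j k) := fun j =>
    congrFun (F.U_U_solZ d j) k
  simp only [Finset.sum_apply, map_sum]
  simp only [Pi.smul_apply (M := fun _ : Fin 8 => A), Derivation.map_smul, e]
  simp only [solConst, Algebra.smul_def, ← map_mul, ← map_sum]
  congr 1
  by_cases hk : k = 7
  · subst hk
    simp [coefU, Ne.symm hd, mul_comm]
  · by_cases hdk : d = k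
    · simp [coefU, hk, hdk, mul_comm]
    · simp [coefU, hk, hd, hdk, Ne.symm hdk]

include hI in
theorem solConst_last_mem {c : Fin 8 → ℝ} (h0 : c ≠ 0) (hc : solConst c ∈ I) :
    solConst (Pi.single 7 1) ∈ I := by
  by_cases h : ∃ d, d ≠ 7 ∧ c d ≠ 0
  · obtain ⟨d, hd, hcd⟩ := h
    obtain ⟨e, he, hed⟩ : ∃ e : Fin 8, e ≠ 7 ∧ e ≠ d := by
      clear hcd
      decide +revert
    have h₃ := solConst_mem_step hI (solConst_mem_step hI (solConst_mem_step hI hc hd) he) he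
    refine solConst_mem_of_smul hcd ?_
    convert h₃ using 2
    simp [← Pi.single_smul, he, hed, Ne.symm he, Ne.symm hd]
  · push Not at h
    have e : c = c 7 • Pi.single 7 1 := funext fun k => by
      by_cases hk : k = 7
      · simp [hk]
      · simp [hk, h k hk]
    refine solConst_mem_of_smul (r := c 7) (fun h7 => h0 ?_) (e ▸ hc)
    rw [e, h7, zero_smul]

include hI in
theorem solConst_mem {c : Fin 8 → ℝ} (h0 : c ≠ 0) (hc : solConst c ∈ I) (i : Fin 8) :
    solConst (Pi.single i 1) ∈ I := by
  have h := solConst_last_mem hI h0 hc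
  by_cases hi : i = 7
  · rwa [hi]
  · simpa [hi, Ne.symm hi] using solConst_mem_step hI h hi

end Ideal

end HFrame

namespace HFrame

variable {A : Type*} [CommRing A] [Algebra ℝ A] (F : HFrame A)

theorem solConst_br (c : Fin 8 → ℝ) (f : Fin 8 → A) :
    F.br (solConst c) f = ∑ j, c j • fun k => F.U j (f k) := by
  rw [br_comm, br_solConst, neg_neg]

/-- The second derivatives of the quadratic solutions `solY`, up to a factor. -/
def coefZ (l i j k : Fin 8) : ℤ :=
  ∑ m, (coefU i j m * coefU l m k + coefU l j m * coefU m i k - coefU l i m * coefU m j k)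

theorem coefZ_of_lt : ∀ k l i j, k < l → i < j →
    coefZ l i j k = if k = i ∧ l = j then 1 else 0 := by
  decide +kernel

theorem coefZ_last : ∀ i j, coefZ i 7 j 7 = if i = j then 1 else 0 := by
  decide +kernel

theorem coefZ_last_of_lt : ∀ i j, i < j → coefZ 7 i j 7 = 0 := by
  decide +kernel

/-- The quadratic solutions, obtained from the top one by bracketing with its derivatives. -/
def solY (j : Fin 8) : Fin 8 → A := F.br (fun k => F.U j (F.solZ k)) F.solZ

theorem U_U_solY (l i j : Fin 8) :
    (fun k => F.U l (F.U i (F.solY j k))) = solConst fun k => 1024 * coefZ l i j k := by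
  have e₁ : ∀ m k, F.U l (F.U m (F.solZ k)) = algebraMap ℝ A (32 * coefU l m k) := fun m =>
    congrFun (F.U_U_solZ l m)
  have e₂ : ∀ i m k, F.U m (F.U i (F.solZ k)) = algebraMap ℝ A (32 * coefU m i k) := fun i m =>
    congrFun (F.U_U_solZ m i)
  have h₁ := F.U_br i (fun k => F.U j (F.solZ k)) F.solZ
  rw [F.U_U_solZ, solConst_br] at h₁
  have h₂ := F.U_br l (fun k => F.U j (F.solZ k)) (fun k => F.U i (F.solZ k))
  rw [F.U_U_solZ, F.U_U_solZ, solConst_br, br_solConst] at h₂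
  funext k
  have h₁k := congrFun h₁ k
  have h₂k := congrFun h₂ k
  simp only [Pi.add_apply, Pi.neg_apply, Finset.sum_apply] at h₁k h₂k
  simp only [solY, h₁k, map_add, map_sum, h₂k]
  simp only [Pi.smul_apply (M := fun _ : Fin 8 => A), Derivation.map_smul, e₂]
  simp only [solConst, Algebra.smul_def, ← map_mul, ← map_sum, ← map_add, ← map_neg, coefZ]
  congr 1
  push_cast
  rw [Finset.mul_sum, ← Finset.sum_neg_distrib, ← Finset.sum_add_distrib,
    ← Finset.sum_add_distrib]
  exact Finset.sum_congr rfl fun m _ => by ring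

theorem X_X_w (a b : Fin 16) (i : Fin 8) :
    2 * F.X b (F.X a (F.w i)) = if b = partner i a then (sgn i a : A) else 0 := by
  have h := congrArg (F.X b) (F.X_w a i)
  rw [Derivation.map_intCast_mul, F.X_z] at h
  simpa [Derivation.map_ofNat] using h

theorem partner_ne_self : ∀ i a, partner i a ≠ a := by
  decide +kernel

theorem X_X_w_self (a : Fin 16) (i : Fin 8) : F.X a (F.X a (F.w i)) = 0 := by
  have h := F.X_X_w a a i
  rw [if_neg (Ne.symm (partner_ne_self i a))] at h
  exact eq_of_two_mul (by rw [sub_zero, h])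

theorem X_X_formH_self (a : Fin 16) {i : Fin 8} (hi : i ≠ 7) (j : Fin 8) :
    F.X a (F.X a (formH F.z i j)) = 0 := by
  rw [F.X_formH a hi]
  by_cases hj : j = i ∨ j = 7
  · simp [coefH, hj]
  · push Not at hj
    have : a ≠ partner i (partner j (partner 7 a)) := fun h => by
      have := half_partner_partner i j a hi hj.1 hj.2
      rw [← h] at this
      simp at this
    simp [Derivation.map_ofNat, Derivation.map_intCast, F.X_z, this]

theorem X_X_U_solZ (a : Fin 16) (i j : Fin 8) : F.X a (F.X a (F.U j (F.solZ i))) = 0 := by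
  by_cases hi : i = 7
  · subst hi
    simp [U_solZ_last, Derivation.map_ofNat, F.X_X_w_self]
  · rw [F.U_solZ hi]
    split_ifs <;> simp [Derivation.map_ofNat, F.X_X_w_self, F.X_X_formH_self a hi]

theorem ev_X_solZ_last : F.ev (F.X 0 (F.X 0 (F.X 0 (F.X 0 (F.solZ 7))))) = 24 := by
  have hw : ∀ j, F.X 0 (F.w j * (sgn j 0 * F.z (partner j 0))) =
      F.X 0 (F.w j) * (sgn j 0 * F.z (partner j 0)) := fun j => by
    have : (0 : Fin 16) ≠ partner j 0 := Ne.symm (partner_ne_self j 0)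
    simp [Derivation.map_intCast, F.X_z, this, mul_comm]
  have hw' : ∀ j, F.X 0 (F.X 0 (F.w j) * (sgn j 0 * F.z (partner j 0))) = 0 := fun j => by
    have : (0 : Fin 16) ≠ partner j 0 := Ne.symm (partner_ne_self j 0)
    simp [Derivation.map_intCast, F.X_z, this, X_X_w_self]
  have hz : ∀ j, F.X 0 (F.X 0 (F.X 0 (coefK j 0 * (formK F.z j * F.z (partner j (partner 7 0)))))) =
      if j = 7 then 6 else 0 := fun j => by
    have e : (0 = partner j (partner 7 0)) = (j = 7) := propext (by revert j; decide)
    have c : (coefK 7 0 : A) = -1 := by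
      have : coefK 7 0 = -1 := by decide +kernel
      simp [this]
    by_cases hj : j = 7
    · subst hj
      have p : partner 7 (partner 7 0) = 0 := partner_partner 7 0
      simp [Derivation.map_ofNat, X_formK, F.X_z, p, c]
      ring
    · simp [Derivation.map_intCast, Derivation.map_ofNat, X_formK, F.X_z, e, hj]
  have m : ∀ (n : ℕ) [n.AtLeastTwo] (g : A), F.X 0 (ofNat(n) * g) = ofNat(n) * F.X 0 g :=
    fun n _ g => by simp [Derivation.map_ofNat]
  rw [X_solZ_last]
  simp only [map_add, m, map_sum, hw, hw', hz]
  simp [map_ofNat F.ev]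
  norm_num

section Surjective

variable {F} {I : Submodule ℝ (Fin 8 → A)} (hle : I ≤ F.sol)
  (hI : ∀ f ∈ F.sol, ∀ g ∈ I, F.br f g ∈ I) (hK : ∀ i, solConst (Pi.single i 1) ∈ I)

include hI hK in
theorem U_solZ_mem (j : Fin 8) : (fun k => F.U j (F.solZ k)) ∈ I := by
  have h := hI _ F.isSol_solZ.mem_sol _ (hK j)
  rw [F.br_solConst, Finset.sum_eq_single j (fun i _ hi => by simp [hi]) (by simp)] at h
  simpa using h

include hI hK in
theorem solE_mem : F.solE ∈ I := by
  have h := U_solZ_mem hI hK 7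
  rw [U_last_solZ] at h
  exact (I.smul_mem_iff (by norm_num)).mp h

include hle hI hK in
theorem solR_mem (a : Fin 16) : F.solR a ∈ I := by
  rw [← opR_solE]
  exact opR_mem_ideal hle hI (solE_mem hI hK) a

include hle hI hK in
theorem opR_solZ_mem (a : Fin 16) : (fun k => F.opR a (F.solZ k)) ∈ I := by
  have h := hI _ F.isSol_solZ.mem_sol _ (solR_mem hle hI hK a)
  rwa [F.br_solR F.isSol_solZ.mem_sol, neg_mem_iff] at h

include hI hK in
theorem solY_mem (j : Fin 8) : F.solY j ∈ I :=
  br_mem_of_left hI (U_solZ_mem hI hK j) F.isSol_solZ.mem_sol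

include hI hK in
theorem exists_jetUU (i : Fin 8) :
    ∃ g ∈ I, (0 : (Fin 8 → A) →ₗ[ℝ] (Fin 0 → ℝ)) g = 0 ∧ ∃ c : ℝ, c ≠ 0 ∧
      F.jetUU g = Pi.single i c := by
  refine ⟨F.solY i, solY_mem hI hK i, rfl, 1024, by norm_num, ?_⟩
  funext j
  have h : F.ev (F.U j (F.U 7 (F.solY i 7))) = _ :=
    congrArg F.ev (congrFun (F.U_U_solY j 7 i) 7)
  refine h.trans ?_
  rw [solConst, AlgHom.commutes, coefZ_last, Pi.single_apply]
  split_ifs <;> simp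

include hle hI hK in
theorem exists_jetXU (c : Fin 16) :
    ∃ g ∈ I, F.jetUU g = 0 ∧ ∃ r : ℝ, r ≠ 0 ∧ F.jetXU g = Pi.single c r := by
  refine ⟨_, opR_solZ_mem hle hI hK (partner 7 c), ?_, 16 * sgn 7 c, ?_, ?_⟩
  · funext i
    have h : F.U i (F.U 7 (F.solZ 7)) = _ := congrFun (F.U_U_solZ i 7) 7
    change F.ev (F.U i (F.U 7 (F.opR _ (F.solZ 7)))) = 0
    rw [U_opR, U_opR, h, ev_opR, solConst, Derivation.map_algebraMap, map_zero]
  · have := cast_sgn_mul_self (R := ℝ) 7 c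
    exact mul_ne_zero (by norm_num) (left_ne_zero_of_mul_eq_one this)
  · funext d
    change F.ev (F.X d (F.U 7 (F.opR _ (F.solZ 7)))) = _
    have h := F.X_X_w d (partner 7 c) 7
    have e : (partner 7 c = partner 7 d) = (d = c) := propext
      ((partner_involutive 7).injective.eq_iff.trans eq_comm)
    have h' : F.X (partner 7 c) (F.X d (32 * F.w 7)) =
        16 * (if d = c then (sgn 7 d : A) else 0) := by
      simp only [e] at h
      rw [← h]
      simp [Derivation.map_ofNat]
      ring
    rw [U_opR, X_opR, ev_opR, U_solZ_last, h', Pi.single_apply]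
    split_ifs with hd
    · simp [hd, map_ofNat F.ev]
    · simp

include hI hK in
theorem exists_jetDiag (i : Fin 1) :
    ∃ g ∈ I, (F.jetUU.prod F.jetXU) g = 0 ∧ ∃ r : ℝ, r ≠ 0 ∧ F.jetDiag g = Pi.single i r := by
  have h : F.U 7 (F.solE 7) = algebraMap ℝ A 2 := by
    simp [solE, Derivation.map_ofNat, F.U_w, map_ofNat (algebraMap ℝ A)]
  refine ⟨_, solE_mem hI hK, Prod.ext (funext fun j => ?_) (funext fun j => ?_), 2, by norm_num,
    funext fun j => ?_⟩
  · change F.ev (F.U j (F.U 7 (F.solE 7))) = 0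
    rw [h, Derivation.map_algebraMap, map_zero]
  · change F.ev (F.X j (F.U 7 (F.solE 7))) = 0
    rw [h, Derivation.map_algebraMap, map_zero]
  · change F.ev (F.U 7 (F.solE 7)) = _
    rw [h, AlgHom.commutes, Subsingleton.elim j i, Pi.single_eq_same, Algebra.algebraMap_self,
      RingHom.id_apply]

include hI hK in
theorem exists_jetU (p : OrderedPair) :
    ∃ g ∈ I, ((F.jetUU.prod F.jetXU).prod F.jetDiag) g = 0 ∧ ∃ r : ℝ, r ≠ 0 ∧
      F.jetU g = Pi.single p r := by
  have h : ∀ l k, F.U l (F.U p.1.1 (F.solY p.1.2 k)) =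
      algebraMap ℝ A (1024 * coefZ l p.1.1 p.1.2 k) := fun l =>
    congrFun (F.U_U_solY l p.1.1 p.1.2)
  refine ⟨_, U_mem_ideal hI (solY_mem hI hK p.1.2) p.1.1,
    Prod.ext (Prod.ext (funext fun j => ?_) (funext fun j => ?_)) (funext fun j => ?_), 1024,
    by norm_num, funext fun q => ?_⟩
  · change F.ev (F.U j (F.U 7 (F.U p.1.1 (F.solY p.1.2 7)))) = 0
    rw [h, Derivation.map_algebraMap, map_zero]
  · change F.ev (F.X j (F.U 7 (F.U p.1.1 (F.solY p.1.2 7)))) = 0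
    rw [h, Derivation.map_algebraMap, map_zero]
  · change F.ev (F.U 7 (F.U p.1.1 (F.solY p.1.2 7))) = 0
    rw [h, coefZ_last_of_lt _ _ p.2]
    simp
  · change F.ev (F.U q.1.2 (F.U p.1.1 (F.solY p.1.2 q.1.1))) = _
    rw [h, coefZ_of_lt _ _ _ _ q.2 p.2, AlgHom.commutes, Pi.single_apply]
    have : (q.1.1 = p.1.1 ∧ q.1.2 = p.1.2) = (q = p) :=
      propext (by rw [Subtype.ext_iff, Prod.ext_iff])
    simp only [this]
    split_ifs <;> simp

include hle hI hK in
theorem exists_jetXX (i : Fin 1) :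
    ∃ g ∈ I, (((F.jetUU.prod F.jetXU).prod F.jetDiag).prod F.jetU) g = 0 ∧ ∃ r : ℝ, r ≠ 0 ∧
      F.jetXX g = Pi.single i r := by
  have hU : ∀ j k, F.ev (F.U j (F.opR 0 (F.opR 0 (F.solZ k)))) = 0 := fun j k => by
    rw [U_opR, U_opR, ev_opR, X_opR, ev_opR, X_X_U_solZ, map_zero]
  refine ⟨_, opR_mem_ideal hle hI (opR_solZ_mem hle hI hK 0) 0,
    Prod.ext (Prod.ext (Prod.ext (funext fun j => ?_) (funext fun j => ?_)) (funext fun j => ?_))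
      (funext fun q => ?_), 24, by norm_num, funext fun j => ?_⟩
  · change F.ev (F.U j (F.U 7 (F.opR 0 (F.opR 0 (F.solZ 7))))) = 0
    rw [U_opR, U_opR, U_opR, U_opR, ev_opR, X_opR, ev_opR]
    rw [F.X_U, F.X_U, X_X_U_solZ, map_zero, map_zero]
  · change F.ev (F.X j (F.U 7 (F.opR 0 (F.opR 0 (F.solZ 7))))) = 0
    have h : F.X 0 (F.X j (32 * F.w 7)) =
        algebraMap ℝ A (16 * if 0 = partner 7 j then sgn 7 j else 0) := by
      have := F.X_X_w j 0 7
      have e : F.X 0 (F.X j (32 * F.w 7)) = 16 * (2 * F.X 0 (F.X j (F.w 7))) := by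
        simp [Derivation.map_ofNat]
        ring
      rw [e, this]
      split_ifs <;> simp [map_ofNat (algebraMap ℝ A)]
    rw [U_opR, U_opR, X_opR, X_opR, ev_opR, X_opR, ev_opR, U_solZ_last, h,
      Derivation.map_algebraMap, map_zero]
  · exact hU 7 7
  · exact hU _ _
  · change F.ev (F.X 0 (F.X 0 (F.opR 0 (F.opR 0 (F.solZ 7))))) = _
    rw [X_opR, X_opR, X_opR, X_opR, ev_opR, X_opR, ev_opR, ev_X_solZ_last,
      Subsingleton.elim j i, Pi.single_eq_same]

theorem jet_eq_zero_of_U_eq_zero {f : Fin 8 → A} (hU : ∀ i j, F.U j (f i) = 0) :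
    (((F.jetUU.prod F.jetXU).prod F.jetDiag).prod F.jetU) f = 0 := by
  refine Prod.ext (Prod.ext (Prod.ext (funext fun j => ?_) (funext fun j => ?_))
    (funext fun j => ?_)) (funext fun q => ?_)
  · change F.ev (F.U j (F.U 7 (f 7))) = 0
    rw [hU, map_zero, map_zero]
  · change F.ev (F.X j (F.U 7 (f 7))) = 0
    rw [hU, map_zero, map_zero]
  · change F.ev (F.U 7 (f 7)) = 0
    rw [hU, map_zero]
  · change F.ev (F.U q.1.2 (f q.1.1)) = 0
    rw [hU, map_zero]

include hle hI hK in
theorem exists_jetX (c : Fin 16) :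
    ∃ g ∈ I, ((((F.jetUU.prod F.jetXU).prod F.jetDiag).prod F.jetU).prod F.jetXX) g = 0 ∧
      ∃ r : ℝ, r ≠ 0 ∧ F.jetX g = Pi.single c r := by
  have hX : ∀ d, F.X d (F.solR (partner 7 c) 7) =
      algebraMap ℝ A ((Pi.single c (sgn 7 c : ℝ) : Fin 16 → ℝ) d) := by
    intro d
    have e : (partner 7 d = partner 7 c) = (d = c) := propext
      (partner_involutive 7).injective.eq_iff
    rw [F.isSol_solR, Pi.single_apply, Pi.single_apply]
    simp only [e]
    split_ifs with h
    · simp [h]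
    · simp
  refine ⟨_, solR_mem hle hI hK (partner 7 c), Prod.ext (jet_eq_zero_of_U_eq_zero fun i j => ?_)
    (funext fun j => ?_), sgn 7 c, ?_, funext fun d => ?_⟩
  · simp [solR, Derivation.map_intCast, F.U_z]
  · change F.ev (F.X 0 (F.X 0 (F.solR _ 7))) = 0
    rw [hX, Derivation.map_algebraMap, map_zero]
  · exact left_ne_zero_of_mul_eq_one (cast_sgn_mul_self (R := ℝ) 7 c)
  · change F.ev (F.X d (F.solR _ 7)) = _
    rw [hX, AlgHom.commutes, Algebra.algebraMap_self, RingHom.id_apply]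

include hK in
theorem exists_jetVal (i : Fin 8) :
    ∃ g ∈ I,
      (((((F.jetUU.prod F.jetXU).prod F.jetDiag).prod F.jetU).prod F.jetXX).prod F.jetX) g = 0 ∧
      ∃ r : ℝ, r ≠ 0 ∧ F.jetVal g = Pi.single i r := by
  have hX : ∀ a j, F.X a (solConst (Pi.single i 1) j) = 0 := fun a j => by
    rw [solConst, Derivation.map_algebraMap]
  refine ⟨_, hK i, Prod.ext (Prod.ext (jet_eq_zero_of_U_eq_zero fun j k => ?_)
    (funext fun j => ?_)) (funext fun j => ?_), 1, one_ne_zero, funext fun j => ?_⟩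
  · rw [solConst, Derivation.map_algebraMap]
  · change F.ev (F.X 0 (F.X 0 (solConst _ 7))) = 0
    rw [hX, map_zero, map_zero]
  · change F.ev (F.X j (solConst _ 7)) = 0
    rw [hX, map_zero]
  · change F.ev (solConst _ j) = _
    rw [solConst, AlgHom.commutes, Algebra.algebraMap_self, RingHom.id_apply]

include hle hI hK in
theorem exists_jet_eq (m : JetSpace) : ∃ g ∈ I, F.jet g = m := by
  refine Submodule.exists_mem_prod_eq ?_ (exists_jetVal hK) m
  refine Submodule.exists_mem_prod_eq ?_ (exists_jetX hle hI hK)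
  refine Submodule.exists_mem_prod_eq ?_ (exists_jetXX hle hI hK)
  refine Submodule.exists_mem_prod_eq ?_ (exists_jetU hI hK)
  refine Submodule.exists_mem_prod_eq ?_ (exists_jetDiag hI hK)
  refine Submodule.exists_mem_prod_eq (fun m => ?_) (exists_jetXU hle hI hK)
  obtain ⟨g, hg, e⟩ := Submodule.exists_mem_prod_eq (L := (0 : _ →ₗ[ℝ] (Fin 0 → ℝ)))
    (fun m => ⟨0, I.zero_mem, Subsingleton.elim _ _⟩) (exists_jetUU (F := F) hI hK) (0, m)
  exact ⟨g, hg, congrArg Prod.snd e⟩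

end Surjective

theorem jet_injOn_sol {f g : Fin 8 → A} (hf : f ∈ F.sol) (hg : g ∈ F.sol)
    (h : F.jet f = F.jet g) : f = g := by
  have := F.sol.sub_mem hf hg
  rw [mem_sol] at this
  exact sub_eq_zero.mp (this.eq_zero_of_jet (by rw [map_sub, h, sub_self]))

/-- The solution space has no proper nonzero ideals. -/
theorem ideal_eq_bot_or_eq_sol {I : Submodule ℝ (Fin 8 → A)} (hle : I ≤ F.sol)
    (hI : ∀ f ∈ F.sol, ∀ g ∈ I, F.br f g ∈ I) : I = ⊥ ∨ I = F.sol := by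
  refine or_iff_not_imp_left.mpr fun hne => le_antisymm hle fun f hf => ?_
  obtain ⟨g, hg, hg0⟩ := Submodule.exists_mem_ne_zero_of_ne_bot hne
  obtain ⟨c, hc0, hc⟩ := exists_solConst_mem hle hI hg hg0
  obtain ⟨g', hg', e⟩ := exists_jet_eq hle hI (solConst_mem hI hc0 hc) (F.jet f)
  exact F.jet_injOn_sol (hle hg') hf e ▸ hg'

theorem finrank_sol : Module.finrank ℝ F.sol = 78 := by
  rw [← finrank_jetSpace]
  refine (LinearEquiv.ofBijective (F.jet.domRestrict F.sol) ⟨fun f g h => ?_, fun m => ?_⟩).finrank_eq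
  · exact Subtype.ext (F.jet_injOn_sol f.2 g.2 h)
  · obtain ⟨g, hg, e⟩ := exists_jet_eq (F := F) le_rfl (fun f hf g hg => br_mem_sol hf hg)
      (fun i => (F.isSol_solConst _).mem_sol) m
    exact ⟨⟨g, hg⟩, e⟩

theorem br_solConst_solE_ne_zero : F.br (solConst (Pi.single 7 1)) F.solE ≠ 0 := fun h => by
  have h := congrArg F.ev (congrFun h 7)
  rw [solConst_br, Finset.sum_eq_single 7 (fun i _ hi => by simp [hi]) (by simp)] at h
  simp [solE, Derivation.map_ofNat, F.U_w, map_ofNat F.ev] at h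

end HFrame

section Coordinates

/-- The index of the coordinate `u^i`. -/
def ui (i : Fin 8) : Fin 24 := Fin.castAdd 16 i

/-- The index of the coordinate `x` or `y` numbered by `a`. -/
def zi (a : Fin 16) : Fin 24 := Fin.natAdd 8 a

theorem ui_injective : Function.Injective ui := Fin.castAdd_injective 8 16

theorem zi_injective : Function.Injective zi := Fin.natAdd_injective 16 8

theorem ui_ne_zi (i : Fin 8) (a : Fin 16) : ui i ≠ zi a := by
  revert i a
  decide +kernel

theorem eq_ui_or_eq_zi : ∀ k, (∃ i, k = ui i) ∨ ∃ a, k = zi a := by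
  decide +kernel

theorem lam_apply (p v : Pt) (i : Fin 8) :
    lam p v i = v (ui i) + ∑ a, coef i a * p (zi a) * v (zi (partner i a)) := by
  fin_cases i <;>
    simp [lam, Fin.sum_univ_succ, coef, partner, ui, zi, Fin.natAdd, Fin.castAdd, Fin.castLE,
      Fin.succ] <;> ring

theorem coef_partner : ∀ i a, coef i (partner i a) = 1 - coef i a := by
  decide +kernel

theorem eq_of_lam_eq {p v w : Pt} (h : ∀ i, lam p v i = lam p w i)
    (hz : ∀ a, v (zi a) = w (zi a)) : v = w := by
  funext k
  obtain ⟨i, rfl⟩ | ⟨a, rfl⟩ := eq_ui_or_eq_zi k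
  · have := h i
    simpa only [lam_apply, hz, add_left_inj] using this
  · exact hz a

theorem lam_add (p v w : Pt) (i : Fin 8) : lam p (v + w) i = lam p v i + lam p w i := by
  simp only [lam_apply, Pi.add_apply, mul_add, Finset.sum_add_distrib]
  ring

theorem lam_smul (p : Pt) (r : ℝ) (v : Pt) (i : Fin 8) : lam p (r • v) i = r * lam p v i := by
  simp only [lam_apply, Pi.smul_apply, smul_eq_mul, mul_add, Finset.mul_sum]
  congr 1
  exact Finset.sum_congr rfl fun a _ => by ring

theorem lam_sum {ι : Type*} (s : Finset ι) (p : Pt) (v : ι → Pt) (i : Fin 8) :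
    lam p (∑ j ∈ s, v j) i = ∑ j ∈ s, lam p (v j) i :=
  map_sum (AddMonoidHom.mk' (fun v => lam p v i) fun v w => lam_add p v w i) v s

/-- The vertical coordinate fields. -/
def frameU (i : Fin 8) : Pt := Pi.single (ui i) 1

/-- The linear part of the frame of the distribution. -/
def frameLin (a : Fin 16) : Pt →L[ℝ] Pt :=
  ∑ i, ((coef i (partner i a) : ℝ) • ContinuousLinearMap.proj (R := ℝ) (φ := fun _ => ℝ)
    (zi (partner i a))).smulRight (frameU i)

/-- The frame of the distribution. -/
def frameX (a : Fin 16) (p : Pt) : Pt := Pi.single (zi a) 1 - frameLin a p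

theorem frameLin_apply (a : Fin 16) (p : Pt) :
    frameLin a p = ∑ i, ((coef i (partner i a) : ℝ) * p (zi (partner i a))) • frameU i := by
  simp [frameLin]

theorem frameU_ui (i j : Fin 8) : frameU i (ui j) = if i = j then 1 else 0 := by
  simp [frameU, Pi.single_apply, ui_injective.eq_iff, eq_comm]

theorem frameU_zi (i : Fin 8) (a : Fin 16) : frameU i (zi a) = 0 := by
  simp [frameU, Ne.symm (ui_ne_zi i a)]

theorem frameX_ui (a : Fin 16) (p : Pt) (i : Fin 8) :
    frameX a p (ui i) = -(coef i (partner i a) * p (zi (partner i a))) := by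
  simp [frameX, frameLin_apply, ui_ne_zi, frameU_ui]

theorem frameX_zi (a : Fin 16) (p : Pt) (b : Fin 16) :
    frameX a p (zi b) = if a = b then 1 else 0 := by
  simp [frameX, frameLin_apply, frameU_zi, Pi.single_apply, zi_injective.eq_iff, eq_comm]

theorem lam_frameU (p : Pt) (i j : Fin 8) : lam p (frameU i) j = if i = j then 1 else 0 := by
  simp [lam_apply, frameU_ui, frameU_zi]

theorem lam_frameX (p : Pt) (a : Fin 16) (j : Fin 8) : lam p (frameX a p) j = 0 := by
  have e : ∀ b, (a = partner j b) = (partner j a = b) := fun b =>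
    propext (by rw [← (partner_involutive j).eq_iff, eq_comm])
  simp only [lam_apply, frameX_ui, frameX_zi, e, mul_ite, mul_one, mul_zero, Finset.sum_ite_eq,
    Finset.mem_univ, if_true, neg_add_cancel]

theorem eq_sum_frame (p v : Pt) :
    v = ∑ j, lam p v j • frameU j + ∑ a, v (zi a) • frameX a p := by
  refine eq_of_lam_eq (p := p) (fun i => ?_) fun b => ?_
  · simp only [lam_add, lam_sum, lam_smul, lam_frameU, lam_frameX]
    simp
  · simp [frameU_zi, frameX_zi]

theorem contDiff_frameX (a : Fin 16) : ContDiff ℝ (⊤ : ℕ∞) (frameX a) :=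
  contDiff_const.sub (frameLin a).contDiff

theorem fderiv_frameX (a : Fin 16) (p : Pt) : fderiv ℝ (frameX a) p = -frameLin a := by
  have : frameX a = fun p => Pi.single (zi a) 1 - frameLin a p := rfl
  rw [this, fderiv_const_sub, ContinuousLinearMap.fderiv]

theorem vfBracket_frameX (a b : Fin 16) (p : Pt) :
    vfBracket (frameX b) (frameX a) p =
      ∑ i, (if partner i a = b then (sgn i a : ℝ) else 0) • frameU i := by
  have e : ∀ i, (a = partner i b) = (partner i a = b) := fun i =>
    propext (by rw [← (partner_involutive i).eq_iff, eq_comm])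
  simp only [vfBracket, fderiv_frameX, neg_apply, frameLin_apply, frameX_zi,
    ← Finset.sum_neg_distrib, ← Finset.sum_sub_distrib, ← neg_smul, ← sub_smul]
  refine Finset.sum_congr rfl fun i _ => ?_
  congr 1
  simp only [e]
  by_cases h : partner i a = b
  · subst h
    simp [partner_partner, coef_partner, sgn]
    ring
  · simp [h, Ne.symm h]

end Coordinates

section Smooth

/-- The algebra of smooth functions. -/
def Smooth : Subalgebra ℝ (Pt → ℝ) where
  carrier := {f | ContDiff ℝ (⊤ : ℕ∞) f}
  mul_mem' {f g} (hf : ContDiff ℝ (⊤ : ℕ∞) f) (hg : ContDiff ℝ (⊤ : ℕ∞) g) := hf.mul hg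
  add_mem' {f g} (hf : ContDiff ℝ (⊤ : ℕ∞) f) (hg : ContDiff ℝ (⊤ : ℕ∞) g) := hf.add hg
  algebraMap_mem' r := show ContDiff ℝ (⊤ : ℕ∞) fun _ : Pt => r from contDiff_const

namespace Smooth

theorem contDiff (f : Smooth) : ContDiff ℝ (⊤ : ℕ∞) (f : Pt → ℝ) := f.2

theorem differentiable (f : Smooth) : Differentiable ℝ (f : Pt → ℝ) :=
  (contDiff f).differentiable (by simp)

theorem contDiff_fderiv (f : Smooth) : ContDiff ℝ (⊤ : ℕ∞) (fderiv ℝ (f : Pt → ℝ)) :=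
  (contDiff f).fderiv_right le_rfl

/-- The derivation of the algebra of smooth functions along a smooth vector field. -/
def along (V : Pt → Pt) (hV : ContDiff ℝ (⊤ : ℕ∞) V) : Derivation ℝ Smooth Smooth :=
  .mk'
    { toFun f := ⟨fun p => fderiv ℝ (f : Pt → ℝ) p (V p), (contDiff_fderiv f).clm_apply hV⟩
      map_add' f g := Subtype.ext <| funext fun p => by
        change fderiv ℝ ((f : Pt → ℝ) + (g : Pt → ℝ)) p (V p) = _
        rw [fderiv_add (differentiable f p) (differentiable g p)]
        rfl
      map_smul' r f := Subtype.ext <| funext fun p => by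
        change fderiv ℝ (r • (f : Pt → ℝ)) p (V p) = _
        rw [fderiv_const_smul (differentiable f p)]
        rfl }
    fun f g => Subtype.ext <| funext fun p => by
      change fderiv ℝ ((f : Pt → ℝ) * (g : Pt → ℝ)) p (V p) = _
      rw [fderiv_mul (differentiable f p) (differentiable g p)]
      rfl

theorem along_apply (V : Pt → Pt) (hV : ContDiff ℝ (⊤ : ℕ∞) V) (f : Smooth) (p : Pt) :
    (along V hV f : Pt → ℝ) p = fderiv ℝ (f : Pt → ℝ) p (V p) := rfl

theorem along_along_sub {V W : Pt → Pt} (hV : ContDiff ℝ (⊤ : ℕ∞) V)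
    (hW : ContDiff ℝ (⊤ : ℕ∞) W) (f : Smooth) (p : Pt) :
    (along V hV (along W hW f) : Pt → ℝ) p - (along W hW (along V hV f) : Pt → ℝ) p =
      fderiv ℝ (f : Pt → ℝ) p (vfBracket V W p) := by
  have h : ∀ {W : Pt → Pt}, ContDiff ℝ (⊤ : ℕ∞) W → ∀ v,
      fderiv ℝ (fun q => fderiv ℝ (f : Pt → ℝ) q (W q)) p v =
        fderiv ℝ (f : Pt → ℝ) p (fderiv ℝ W p v) +
          fderiv ℝ (fderiv ℝ (f : Pt → ℝ)) p v (W p) := fun {W} hW v => by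
    rw [fderiv_clm_apply ((contDiff_fderiv f).differentiable (by simp) p)
      (hW.differentiable (by simp) p)]
    simp
  have hs : IsSymmSndFDerivAt ℝ (f : Pt → ℝ) p :=
    (contDiff f).contDiffAt.isSymmSndFDerivAt <| by
      rw [minSmoothness_of_isRCLikeNormedField]
      exact WithTop.coe_le_coe.mpr (le_top : (2 : ℕ∞) ≤ ⊤)
  change fderiv ℝ (fun q => fderiv ℝ (f : Pt → ℝ) q (W q)) p (V p) -
    fderiv ℝ (fun q => fderiv ℝ (f : Pt → ℝ) q (V q)) p (W p) = _
  rw [h hW, h hV, hs.eq (V p) (W p), vfBracket, map_sub]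
  ring

/-- The coordinate functions. -/
def coord (k : Fin 24) : Smooth :=
  ⟨fun p => p k, show ContDiff ℝ (⊤ : ℕ∞) fun p : Pt => p k from contDiff_apply ℝ ℝ k⟩

theorem along_coord (V : Pt → Pt) (hV : ContDiff ℝ (⊤ : ℕ∞) V) (k : Fin 24) (p : Pt) :
    (along V hV (coord k) : Pt → ℝ) p = V p k := by
  have : fderiv ℝ (fun p : Pt => p k) p = ContinuousLinearMap.proj k :=
    (ContinuousLinearMap.proj (R := ℝ) (φ := fun _ : Fin 24 => ℝ) k).fderiv
  rw [along_apply, coord, this]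
  rfl

/-- The evaluation at the origin. -/
def evalZero : Smooth →ₐ[ℝ] ℝ := (Pi.evalAlgHom ℝ (fun _ : Pt => ℝ) 0).comp Smooth.val

theorem intCast_apply (n : ℤ) (p : Pt) : ((n : Smooth) : Pt → ℝ) p = n := by
  rw [SubringClass.coe_intCast, Pi.intCast_apply]

theorem fderiv_eq_sum (f : Smooth) (p v : Pt) :
    fderiv ℝ (f : Pt → ℝ) p v =
      ∑ j, lam p v j * fderiv ℝ (f : Pt → ℝ) p (frameU j) +
        ∑ a, v (zi a) * fderiv ℝ (f : Pt → ℝ) p (frameX a p) := by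
  conv_lhs => rw [eq_sum_frame p v]
  simp only [map_add, map_sum, map_smul, smul_eq_mul]

/-- The derivations along the frame of the distribution. -/
def dX (a : Fin 16) : Derivation ℝ Smooth Smooth := along (frameX a) (contDiff_frameX a)

/-- The derivations along the vertical coordinate fields. -/
def dU (i : Fin 8) : Derivation ℝ Smooth Smooth := along (fun _ => frameU i) contDiff_const

theorem dX_dX_sub (a b : Fin 16) (g : Smooth) :
    dX b (dX a g) - dX a (dX b g) = ∑ i, if partner i a = b then sgn i a * dU i g else 0 := by
  refine Subtype.ext <| funext fun p => ?_
  have h := along_along_sub (contDiff_frameX b) (contDiff_frameX a) g p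
  rw [vfBracket_frameX, map_sum] at h
  refine h.trans ?_
  rw [AddSubmonoidClass.coe_finsetSum, Finset.sum_apply]
  refine Finset.sum_congr rfl fun i _ => ?_
  rw [map_smul, smul_eq_mul]
  split_ifs
  · rw [MulMemClass.coe_mul, Pi.mul_apply, intCast_apply]
    rfl
  · simp

theorem dX_dU (a : Fin 16) (i : Fin 8) (g : Smooth) : dX a (dU i g) = dU i (dX a g) := by
  refine Subtype.ext <| funext fun p => sub_eq_zero.mp ?_
  refine (along_along_sub (contDiff_frameX a) contDiff_const g p).trans ?_
  simp [vfBracket, fderiv_frameX, frameLin_apply, frameU_zi]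

theorem dU_dU (i j : Fin 8) (g : Smooth) : dU i (dU j g) = dU j (dU i g) := by
  refine Subtype.ext <| funext fun p => sub_eq_zero.mp ?_
  refine (along_along_sub contDiff_const contDiff_const g p).trans ?_
  simp [vfBracket]

theorem dX_coord_zi (a b : Fin 16) : dX a (coord (zi b)) = if a = b then 1 else 0 := by
  refine Subtype.ext <| funext fun p => ?_
  rw [dX, along_coord, frameX_zi]
  split_ifs <;> rfl

theorem dX_coord_ui (a : Fin 16) (i : Fin 8) :
    dX a (coord (ui i)) = -(coef i (partner i a) * coord (zi (partner i a))) := by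
  refine Subtype.ext <| funext fun p => ?_
  rw [dX, along_coord, frameX_ui, NegMemClass.coe_neg, Pi.neg_apply, MulMemClass.coe_mul,
    Pi.mul_apply, intCast_apply]
  rfl

theorem dU_coord_zi (i : Fin 8) (b : Fin 16) : dU i (coord (zi b)) = 0 := by
  refine Subtype.ext <| funext fun p => ?_
  rw [dU, along_coord, frameU_zi]
  rfl

theorem dU_coord_ui (i j : Fin 8) : dU i (coord (ui j)) = if i = j then 1 else 0 := by
  refine Subtype.ext <| funext fun p => ?_
  rw [dU, along_coord, frameU_ui]
  split_ifs <;> rfl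

/-- The fibre coordinates, symmetrized. -/
def wCoord (i : Fin 8) : Smooth :=
  coord (ui i) + (2⁻¹ : ℝ) • ∑ a, coef i a * (coord (zi a) * coord (zi (partner i a)))

theorem two_mul_wCoord (i : Fin 8) : 2 * wCoord i =
    2 * coord (ui i) + ∑ a, coef i a * (coord (zi a) * coord (zi (partner i a))) := by
  have : (2 : Smooth) = algebraMap ℝ Smooth 2 := (map_ofNat _ 2).symm
  rw [wCoord, mul_add, mul_smul_comm, this, ← Algebra.smul_def, ← Algebra.smul_def, smul_smul]
  norm_num

theorem two_mul_dX_wCoord (a : Fin 16) (i : Fin 8) :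
    2 * dX a (wCoord i) = sgn i a * coord (zi (partner i a)) := by
  have h := congrArg (dX a) (two_mul_wCoord i)
  have e : ∀ b, (a = partner i b) = (partner i a = b) := fun b =>
    propext (by rw [← (partner_involutive i).eq_iff, eq_comm])
  have hc : (coef i (partner i a) : Smooth) = 1 - coef i a := by
    exact_mod_cast congrArg (Int.cast (R := Smooth)) (coef_partner i a)
  simp only [map_add, map_sum, Derivation.leibniz, Derivation.map_ofNat, Derivation.map_intCast,
    smul_eq_mul, mul_zero, add_zero, dX_coord_ui, dX_coord_zi, mul_ite, mul_one, mul_add,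
    Finset.sum_add_distrib, e, Finset.sum_ite_eq, Finset.mem_univ, if_true, hc] at h
  rw [h, sgn]
  push_cast
  ring

theorem dU_wCoord (i j : Fin 8) : dU i (wCoord j) = if i = j then 1 else 0 := by
  simp [wCoord, Derivation.map_intCast, dU_coord_ui, dU_coord_zi]

/-- The frame of derivations of the algebra of smooth functions. -/
def frame : HFrame Smooth where
  X := dX
  U := dU
  z a := coord (zi a)
  w := wCoord
  ev := evalZero
  X_partner i a g := by
    have e : ∀ j, (partner j a = partner i a) = (j = i) := fun j =>
      propext ⟨partner_injective j i a, fun h => h ▸ rfl⟩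
    rw [dX_dX_sub]
    simp only [e, Finset.sum_ite_eq', Finset.mem_univ, if_true]
  X_comm a b g h := by
    have := dX_dX_sub a b g
    simp only [h, if_false, Finset.sum_const_zero] at this
    exact (sub_eq_zero.mp this).symm
  X_U := dX_dU
  U_comm := dU_dU
  X_z := dX_coord_zi
  U_z := dU_coord_zi
  X_w := two_mul_dX_wCoord
  U_w := dU_wCoord
  ev_z _ := rfl
  ev_w i := by
    have h := congrArg evalZero (two_mul_wCoord i)
    have h0 : ∀ k, evalZero (coord k) = 0 := fun _ => rfl
    simp only [map_mul, map_add, map_sum, h0, map_ofNat evalZero] at h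
    simpa using h
  eq_of_X_eq_zero g hX hU := by
    refine Subtype.ext <| funext fun p =>
      is_const_of_fderiv_eq_zero (differentiable g) (fun q => ?_) p 0
    refine ContinuousLinearMap.ext fun v => ?_
    have hX' : ∀ a, fderiv ℝ (g : Pt → ℝ) q (frameX a q) = 0 := fun a =>
      congrFun (congrArg Subtype.val (hX a)) q
    have hU' : ∀ i, fderiv ℝ (g : Pt → ℝ) q (frameU i) = 0 := fun i =>
      congrFun (congrArg Subtype.val (hU i)) q
    rw [fderiv_eq_sum]
    simp [hX', hU']

end Smooth

end Smooth

section Fields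

open Smooth

theorem fderiv_lam {W : Pt → Pt} (hW : Differentiable ℝ W) (p v : Pt) (i : Fin 8) :
    fderiv ℝ (fun q => lam q (W q) i) p v = lam p (fderiv ℝ W p v) i +
      ∑ b, coef i b * (v (zi b) * W p (zi (partner i b))) := by
  have hc : ∀ k, HasFDerivAt (fun q => W q k)
      ((ContinuousLinearMap.proj k).comp (fderiv ℝ W p)) p :=
    hasFDerivAt_pi'.mp (hW p).hasFDerivAt
  have hp : ∀ k : Fin 24, HasFDerivAt (fun q : Pt => q k)
      (ContinuousLinearMap.proj (R := ℝ) (φ := fun _ => ℝ) k) p := fun k =>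
    (ContinuousLinearMap.proj (R := ℝ) (φ := fun _ : Fin 24 => ℝ) k).hasFDerivAt
  have h := (hc (ui i)).add (HasFDerivAt.fun_sum (u := Finset.univ) fun a _ =>
    ((hp (zi a)).const_mul (coef i a : ℝ)).mul (hc (zi (partner i a))))
  have e : (fun q => lam q (W q) i) = _ := funext fun q => lam_apply q (W q) i
  rw [e]
  refine (congrArg (fun L : Pt →L[ℝ] ℝ => L v) h.fderiv).trans ?_
  rw [lam_apply, add_assoc, ← Finset.sum_add_distrib]
  simp only [add_apply, sum_apply, smul_apply, ContinuousLinearMap.comp_apply,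
    ContinuousLinearMap.proj_apply, smul_eq_mul]
  congr 1
  exact Finset.sum_congr rfl fun b _ => by ring

theorem sum_sgn_mul_comm (v w : Fin 16 → ℝ) (i : Fin 8) :
    ∑ b, (sgn i b : ℝ) * (v b * w (partner i b)) =
      -∑ b, sgn i b * (w b * v (partner i b)) := by
  rw [← Equiv.sum_comp (partner_involutive i).toPerm, ← Finset.sum_neg_distrib]
  refine Finset.sum_congr rfl fun b _ => ?_
  simp only [Function.Involutive.coe_toPerm, partner_partner, cast_sgn_partner]
  ring

theorem lam_vfBracket {V W : Pt → Pt} (hV : Differentiable ℝ V) (hW : Differentiable ℝ W)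
    (p : Pt) (i : Fin 8) :
    lam p (vfBracket V W p) i = fderiv ℝ (fun q => lam q (W q) i) p (V p) -
      fderiv ℝ (fun q => lam q (V q) i) p (W p) -
      ∑ b, sgn i b * (V p (zi b) * W p (zi (partner i b))) := by
  have e : ∑ b, (coef i b : ℝ) * (W p (zi b) * V p (zi (partner i b))) =
      ∑ b, (coef i b - sgn i b) * (V p (zi b) * W p (zi (partner i b))) := by
    rw [← Equiv.sum_comp (partner_involutive i).toPerm]
    refine Finset.sum_congr rfl fun b _ => ?_
    simp only [Function.Involutive.coe_toPerm, partner_partner, coef_partner, sgn]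
    push_cast
    ring
  have hs : lam p (vfBracket V W p) i =
      lam p (fderiv ℝ W p (V p)) i - lam p (fderiv ℝ V p (W p)) i := by
    rw [vfBracket, sub_eq_add_neg, ← neg_one_smul ℝ, lam_add, lam_smul]
    ring
  rw [hs, fderiv_lam hV, fderiv_lam hW, e]
  simp only [sub_mul, Finset.sum_sub_distrib]
  ring

/-- The vector field with vertical components `f`, as determined by the structure equations. -/
def toField : (Fin 8 → Smooth) →ₗ[ℝ] (Pt → Pt) where
  toFun f p := ∑ j, (f j : Pt → ℝ) p • frameU j + ∑ a, (frame.yOf f a : Pt → ℝ) p • frameX a p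
  map_add' f g := funext fun p => by
    have h : ∀ a, frame.yOf (f + g) a = frame.yOf f a + frame.yOf g a := fun a => by
      simp only [HFrame.yOf, Pi.add_apply, map_add]
      ring
    simp only [h, Pi.add_apply, AddMemClass.coe_add, add_smul, Finset.sum_add_distrib]
    abel
  map_smul' r f := funext fun p => by
    have h : ∀ a, frame.yOf (r • f) a = r • frame.yOf f a := fun a => by
      simp only [HFrame.yOf, Pi.smul_apply, Derivation.map_smul, mul_smul_comm, smul_neg]
    simp only [h, Pi.smul_apply, SetLike.val_smul, smul_assoc, ← Finset.smul_sum, smul_add,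
      RingHom.id_apply]

theorem toField_apply (f : Fin 8 → Smooth) (p : Pt) : toField f p =
    ∑ j, (f j : Pt → ℝ) p • frameU j + ∑ a, (frame.yOf f a : Pt → ℝ) p • frameX a p := rfl

theorem lam_toField (f : Fin 8 → Smooth) (p : Pt) (i : Fin 8) :
    lam p (toField f p) i = (f i : Pt → ℝ) p := by
  simp only [toField_apply, lam_add, lam_sum, lam_smul, lam_frameU, lam_frameX]
  simp

theorem toField_zi (f : Fin 8 → Smooth) (p : Pt) (a : Fin 16) :
    toField f p (zi a) = (frame.yOf f a : Pt → ℝ) p := by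
  simp [toField_apply, frameU_zi, frameX_zi]

theorem toField_injective : Function.Injective toField := fun f g h => funext fun i =>
  Subtype.ext <| funext fun p => by rw [← lam_toField, h, lam_toField]

theorem contDiff_toField (f : Fin 8 → Smooth) : ContDiff ℝ (⊤ : ℕ∞) (toField f) :=
  (ContDiff.sum fun j _ => (contDiff (f j)).smul contDiff_const).add
    (ContDiff.sum fun a _ => (contDiff _).smul (contDiff_frameX a))

theorem differentiable_toField (f : Fin 8 → Smooth) : Differentiable ℝ (toField f) :=
  (contDiff_toField f).differentiable (by simp)

theorem fderiv_toField (f : Fin 8 → Smooth) (h : Smooth) (p : Pt) :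
    fderiv ℝ (h : Pt → ℝ) p (toField f p) = (frame.act f h : Pt → ℝ) p := by
  rw [fderiv_eq_sum]
  simp only [lam_toField, toField_zi, HFrame.act, AddMemClass.coe_add, AddSubmonoidClass.coe_finsetSum,
    Pi.add_apply, Finset.sum_apply, MulMemClass.coe_mul, Pi.mul_apply]
  rfl

theorem vfBracket_toField {f g : Fin 8 → Smooth} (hf : f ∈ frame.sol) (hg : g ∈ frame.sol) :
    vfBracket (toField f) (toField g) = toField (frame.br f g) := by
  funext p
  have hlam : ∀ f i, (fun q => lam q (toField f q) i) = (f i : Pt → ℝ) := fun f i =>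
    funext fun q => lam_toField f q i
  have hzi : ∀ f g a, fderiv ℝ (toField g) p (toField f p) (zi a) =
      (frame.act f (frame.yOf g a) : Pt → ℝ) p := fun f g a => by
    rw [← fderiv_toField]
    have e : (frame.yOf g a : Pt → ℝ) = fun q => toField g q (zi a) :=
      funext fun q => (toField_zi g q a).symm
    rw [e, fderiv_apply (differentiable_toField g p)]
    rfl
  refine eq_of_lam_eq (p := p) (fun i => ?_) fun a => ?_
  · rw [lam_vfBracket (differentiable_toField f) (differentiable_toField g), hlam, hlam,
      fderiv_toField, fderiv_toField, lam_toField,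
      HFrame.act_of_isSol (frame.mem_sol.mp hf), HFrame.act_of_isSol (frame.mem_sol.mp hg)]
    have e := sum_sgn_mul_comm (fun a => (frame.yOf g a : Pt → ℝ) p)
      (fun a => (frame.yOf f a : Pt → ℝ) p) i
    simp only [toField_zi, HFrame.br, AddMemClass.coe_add, AddSubmonoidClass.coe_finsetSum,
      Pi.add_apply, Finset.sum_apply, MulMemClass.coe_mul, Pi.mul_apply, intCast_apply,
      AddSubgroupClass.coe_sub, Pi.sub_apply, Finset.sum_sub_distrib, e]
    ring
  · have h := (HFrame.isSol_br hf hg).yOf_eq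
    rw [vfBracket, Pi.sub_apply, hzi, hzi, toField_zi, h]
    rfl

theorem toField_mem_symH {f : Fin 8 → Smooth} (hf : f ∈ frame.sol) : toField f ∈ symH := by
  refine ⟨contDiff_toField f, fun X hX p i => ?_⟩
  have hlam : (fun q => lam q (toField f q) i) = (f i : Pt → ℝ) :=
    funext fun q => lam_toField f q i
  have h0 : (fun q => lam q (X q) i) = fun _ => 0 := funext fun q => hX.2 q i
  have hs := frame.mem_sol.mp hf i
  have hs' : ∀ a, fderiv ℝ (f i : Pt → ℝ) p (frameX a p) =
      sgn i a * (frame.yOf f (partner i a) : Pt → ℝ) p := fun a => by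
    rw [← intCast_apply]
    exact congrFun (congrArg Subtype.val (hs a)) p
  have e := sum_sgn_mul_comm (fun a => (frame.yOf f a : Pt → ℝ) p) (fun a => X p (zi a)) i
  rw [lam_vfBracket (differentiable_toField f) (hX.1.differentiable (by simp)), hlam, h0,
    fderiv_eq_sum]
  simp only [hX.2, toField_zi, e, hs', fderiv_fun_const, Pi.zero_apply, zero_apply, zero_mul,
    Finset.sum_const_zero, mul_left_comm]
  ring

theorem isSectionH_frameX (a : Fin 16) : IsSectionH (frameX a) :=
  ⟨contDiff_frameX a, fun p i => lam_frameX p a i⟩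

theorem exists_toField_eq {Y : Pt → Pt} (hY : Y ∈ symH) : ∃ f ∈ frame.sol, toField f = Y := by
  obtain ⟨hs, hY⟩ := hY
  have hc : ∀ k, ContDiff ℝ (⊤ : ℕ∞) fun p => Y p k := contDiff_pi.mp hs
  have hl : ∀ i, ContDiff ℝ (⊤ : ℕ∞) fun p => lam p (Y p) i := fun i => by
    simp only [lam_apply]
    exact (hc _).add <| ContDiff.sum fun a _ =>
      (contDiff_const.mul (contDiff_apply ℝ ℝ (zi a))).mul (hc _)
  have h : frame.IsSol (fun i => ⟨_, hl i⟩) fun a => ⟨_, hc (zi a)⟩ := fun i a => by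
    refine Subtype.ext <| funext fun p => ?_
    have h := hY _ (isSectionH_frameX a) p i
    have h0 : (fun q => lam q (frameX a q) i) = fun _ => 0 := funext fun q => lam_frameX q a i
    have e := sum_sgn_mul_comm (fun a => Y p (zi a)) (fun b => frameX a p (zi b)) i
    rw [lam_vfBracket (hs.differentiable (by simp)) ((contDiff_frameX a).differentiable (by simp)),
      h0, e] at h
    simp only [frameX_zi, fderiv_fun_const, Pi.zero_apply, zero_apply, ite_mul, one_mul, zero_mul,
      mul_ite, mul_zero, Finset.sum_ite_eq, Finset.mem_univ, if_true] at h
    rw [MulMemClass.coe_mul, Pi.mul_apply, intCast_apply]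
    change fderiv ℝ (fun q => lam q (Y q) i) p (frameX a p) = sgn i a * Y p (zi (partner i a))
    linarith
  refine ⟨_, h.mem_sol, funext fun p => eq_of_lam_eq (p := p) (fun i => lam_toField _ p i)
    fun a => ?_⟩
  rw [toField_zi, h.yOf_eq]

end Fields

/-- The infinitesimal symmetries of the rank-16 distribution on `ℝ²⁴` annihilated by
the eight 1-forms of the E_III Pfaffian system form a Lie subalgebra of the Lie algebra
of smooth vector fields which, as an abstract real Lie algebra, is simple of
dimension 78 (the real form E_III of the exceptional Lie algebra 𝔢₆). -/
theorem EIII_distribution_symmetries_simple_dim_78 :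
    ∃ W : Submodule ℝ (Pt → Pt),
      -- the symmetries form a linear subspace of the space of vector fields …
      (W : Set (Pt → Pt)) = symH ∧
      -- … closed under the Lie bracket of vector fields, i.e. a Lie subalgebra, …
      (∀ Y ∈ W, ∀ Z ∈ W, vfBracket Y Z ∈ W) ∧
      -- … which, as an abstract real Lie algebra, is simple:
      -- it has no Lie ideals other than 0 and itself, …
      (∀ I : Submodule ℝ (Pt → Pt), I ≤ W →
        (∀ Y ∈ W, ∀ Z ∈ I, vfBracket Y Z ∈ I) → I = ⊥ ∨ I = W) ∧
      -- … it is not abelian, …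
      (¬ ∀ Y ∈ W, ∀ Z ∈ W, vfBracket Y Z = 0) ∧
      -- … and it has dimension 78.
      Module.finrank ℝ ↥W = 78 := by
  refine ⟨Smooth.frame.sol.map toField, ?_, ?_, ?_, ?_, ?_⟩
  · refine Set.Subset.antisymm ?_ fun Y hY => exists_toField_eq hY
    rintro _ ⟨f, hf, rfl⟩
    exact toField_mem_symH hf
  · rintro _ ⟨f, hf, rfl⟩ _ ⟨g, hg, rfl⟩
    rw [vfBracket_toField hf hg]
    exact Submodule.mem_map_of_mem (HFrame.br_mem_sol hf hg)
  · intro I hle hI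
    have hJ : I = (I.comap toField).map toField := by
      rw [Submodule.map_comap_eq, inf_eq_right.mpr (hle.trans LinearMap.map_le_range)]
    have hle' : I.comap toField ≤ Smooth.frame.sol := fun f hf => by
      obtain ⟨g, hg, e⟩ := hle hf
      exact toField_injective e ▸ hg
    obtain h | h := Smooth.frame.ideal_eq_bot_or_eq_sol hle' fun f hf g hg => by
      rw [Submodule.mem_comap, ← vfBracket_toField hf (hle' hg)]
      exact hI _ (Submodule.mem_map_of_mem hf) _ hg
    · left
      rw [hJ, h, Submodule.map_bot]
    · right
      rw [hJ, h]
  · intro h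
    have hc : HFrame.solConst (Pi.single 7 1) ∈ Smooth.frame.sol :=
      (Smooth.frame.isSol_solConst _).mem_sol
    have hE : Smooth.frame.solE ∈ Smooth.frame.sol := Smooth.frame.isSol_solE.mem_sol
    refine Smooth.frame.br_solConst_solE_ne_zero (toField_injective ?_)
    rw [← vfBracket_toField hc hE, map_zero]
    exact h _ (Submodule.mem_map_of_mem hc) _ (Submodule.mem_map_of_mem hE)
  · rw [← Smooth.frame.finrank_sol]
    exact (Submodule.equivMapOfInjective toField toField_injective _).finrank_eq.symm
end
end

section
/- The rank-16 distribution H on R^24 annihilated by the eight E_III 1-forms λ^1,…,λ^8 is bracket generating in one step with growth vector (16,24): at every point p of R^24, the tangent space T_p R^24 is spanned by the values at p of smooth sections of H together with the values at p of Lie brackets [X,Y] of smooth sections X,Y of H. -/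
noncomputable section
open ComplexConjugate

/-- The forms `λ^i` at the point `p`, as a linear map in the tangent vector. -/
def lamLinear (p : Pt) : Pt →ₗ[ℝ] (Fin 8 → ℝ) where
  toFun := lam p
  map_add' v w := by
    ext i
    fin_cases i <;> simp [lam] <;> ring
  map_smul' c v := by
    ext i
    fin_cases i <;> simp [lam] <;> ring

/-- The inclusion of the `u`-directions into the tangent space. -/
def vert : (Fin 8 → ℝ) →ₗ[ℝ] Pt where
  toFun c i := if h : (i : ℕ) < 8 then c ⟨i, h⟩ else 0
  map_add' c d := by
    ext i
    by_cases h : (i : ℕ) < 8 <;> simp [h]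
  map_smul' r c := by
    ext i
    by_cases h : (i : ℕ) < 8 <;> simp [h]

theorem lam_vert (p : Pt) (c : Fin 8 → ℝ) : lam p (vert c) = c := by
  ext i
  fin_cases i <;> simp [lam, vert]

/-- The part of `lam q a` that depends on the base point, which is linear in `q`. -/
def lamVar (a : Pt) : Pt →ₗ[ℝ] (Fin 8 → ℝ) where
  toFun q := lam q a - lam 0 a
  map_add' q r := by
    ext i
    fin_cases i <;> simp [lam] <;> ring
  map_smul' c q := by
    ext i
    fin_cases i <;> simp [lam] <;> ring

theorem lamVar_apply (a q : Pt) : lamVar a q = lam q a - lam 0 a := rfl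

theorem lamVar_vert (a : Pt) (c : Fin 8 → ℝ) : lamVar a (vert c) = 0 := by
  ext i
  fin_cases i <;> simp [lamVar, lam, vert]

/-- The horizontal projection of the constant vector field `a` along the `u`-directions. -/
def horiz (a : Pt) : Pt → Pt := fun q => a - vert (lam q a)

/-- The derivative of `horiz a`, which is the same at every point. -/
def horizDeriv (a : Pt) : Pt →L[ℝ] Pt :=
  LinearMap.toContinuousLinearMap (-(vert ∘ₗ lamVar a))

theorem horizDeriv_apply (a q : Pt) : horizDeriv a q = -vert (lamVar a q) := rfl

theorem horiz_eq (a : Pt) : horiz a = fun q => horiz a 0 + horizDeriv a q := by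
  ext1 q
  simp only [horiz, horizDeriv_apply, lamVar_apply, map_sub]
  abel

theorem hasFDerivAt_horiz (a p : Pt) : HasFDerivAt (horiz a) (horizDeriv a) p := by
  rw [horiz_eq]
  exact (horizDeriv a).hasFDerivAt.const_add _

theorem isSectionH_horiz (a : Pt) : IsSectionH (horiz a) := by
  constructor
  · rw [horiz_eq]
    exact contDiff_const.add (horizDeriv a).contDiff
  · intro p i
    have h : lam p (horiz a p) = 0 := by
      change lamLinear p (a - vert (lam p a)) = 0
      rw [map_sub]
      exact sub_eq_zero.2 (lam_vert p _).symm
    rw [h, Pi.zero_apply]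

theorem vfBracket_horiz (a b p : Pt) :
    vfBracket (horiz a) (horiz b) p = vert (lamVar a b - lamVar b a) := by
  simp only [vfBracket, (hasFDerivAt_horiz _ p).fderiv, horizDeriv_apply]
  simp only [horiz, map_sub, lamVar_vert]
  simp only [map_zero]
  abel

/-- Brackets with the horizontal projection of `∂/∂x^1` reach every `u`-direction. -/
theorem exists_lamVar_sub_eq (c : Fin 8 → ℝ) :
    ∃ a b : Pt, lamVar a b - lamVar b a = c := by
  refine ⟨![0, 0, 0, 0, 0, 0, 0, 0, 0, -c 3, -c 6, 0, -c 5, 0, 0, 0,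
      c 7, 0, 0, c 1, 0, c 4, c 2, c 0], Pi.single 8 1, ?_⟩
  ext i
  fin_cases i <;> simp [lamVar, lam]

theorem setOf_section_values (p : Pt) :
    {x : Pt | ∃ X : Pt → Pt, IsSectionH X ∧ X p = x} = LinearMap.ker (lamLinear p) := by
  ext x
  constructor
  · rintro ⟨X, hX, rfl⟩
    exact funext (hX.2 p)
  · intro hx
    refine ⟨horiz x, isSectionH_horiz x, ?_⟩
    have hx' : lam p x = 0 := hx
    simp [horiz, hx']

theorem finrank_ker_lamLinear (p : Pt) :
    Module.finrank ℝ (LinearMap.ker (lamLinear p)) = 16 := by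
  have h := (lamLinear p).finrank_range_add_finrank_ker
  rw [LinearMap.range_eq_top.2 fun c => ⟨vert c, lam_vert p c⟩, finrank_top] at h
  simp only [Module.finrank_fin_fun] at h
  omega

/-- The rank-16 distribution on `ℝ²⁴` annihilated by the eight 1-forms of the
E_III Pfaffian system is bracket generating in one step, with growth vector `(16, 24)`. -/
theorem EIII_distribution_bracket_generating :
    ∀ p : Pt,
      -- the values at `p` of smooth sections of `H` span a 16-dimensional subspace …
      Module.finrank ℝ
        ↥(Submodule.span ℝ {x : Pt | ∃ X : Pt → Pt, IsSectionH X ∧ X p = x}) = 16 ∧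
      -- … and together with values at `p` of brackets of sections they span all of `T_p ℝ²⁴`.
      Submodule.span ℝ
        ({x : Pt | ∃ X : Pt → Pt, IsSectionH X ∧ X p = x} ∪
          {x : Pt | ∃ X Y : Pt → Pt, IsSectionH X ∧ IsSectionH Y ∧ vfBracket X Y p = x}) = ⊤ := by
  intro p
  refine ⟨?_, ?_⟩
  · rw [setOf_section_values, Submodule.span_eq]
    exact finrank_ker_lamLinear p
  · rw [eq_top_iff]
    intro v _
    obtain ⟨a, b, hab⟩ := exists_lamVar_sub_eq (lam p v)
    have hv : v = horiz v p + vert (lam p v) := (sub_add_cancel _ _).symm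
    rw [hv]
    refine add_mem (Submodule.subset_span (Or.inl ⟨_, isSectionH_horiz v, rfl⟩))
      (Submodule.subset_span (Or.inr ⟨_, _, isSectionH_horiz a, isSectionH_horiz b, ?_⟩))
    rw [vfBracket_horiz, hab]
end
end

section
/- The bilinear bracket on the 24-dimensional real vector space n_{E_III} with basis X_1,…,X_24 defined by the E_III structure equations satisfies the Jacobi identity and makes n_{E_III} = n_{−2} ⊕ n_{−1} a 2-step nilpotent graded Lie algebra: n_{−2} = span(X_1,…,X_8) is central, [n_{−1}, n_{−1}] = n_{−2} (so the algebra is fundamental, i.e. generated by n_{−1} = span(X_9,…,X_24)), and [n_{E_III}, [n_{E_III}, n_{E_III}]] = 0. -/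
noncomputable section
open ComplexConjugate

/-- The bracket of the 24-dimensional 2-step nilpotent Lie algebra `n_{E_III}`, in the
basis `X_1, …, X_24` (indexed here by `0, …, 23`): for each term `ε·λ^B∧λ^D` in the E_III
structure equations one has `[X_B, X_D] = -ε·X_A`, and `X_1, …, X_8` are central. -/
def br (v w : Pt) : Pt := fun k =>
  if h : (k : ℕ) < 8 then
    (![-((v 8 * w 23 - v 23 * w 8) + (v 9 * w 19 - v 19 * w 9)
        + (v 10 * w 22 - v 22 * w 10) + (v 11 * w 17 - v 17 * w 11)
        + (v 12 * w 21 - v 21 * w 12) + (v 13 * w 20 - v 20 * w 13)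
        + (v 14 * w 18 - v 18 * w 14) + (v 15 * w 16 - v 16 * w 15)),
       -((v 8 * w 19 - v 19 * w 8) + (v 23 * w 9 - v 9 * w 23)
        + (v 21 * w 10 - v 10 * w 21) + (v 11 * w 16 - v 16 * w 11)
        + (v 12 * w 22 - v 22 * w 12) + (v 18 * w 13 - v 13 * w 18)
        + (v 14 * w 20 - v 20 * w 14) + (v 17 * w 15 - v 15 * w 17)),
       -((v 8 * w 22 - v 22 * w 8) + (v 9 * w 21 - v 21 * w 9)
        + (v 23 * w 10 - v 10 * w 23) + (v 20 * w 11 - v 11 * w 20)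
        + (v 19 * w 12 - v 12 * w 19) + (v 13 * w 17 - v 17 * w 13)
        + (v 14 * w 16 - v 16 * w 14) + (v 18 * w 15 - v 15 * w 18)),
       -((v 9 * w 8 - v 8 * w 9) + (v 12 * w 10 - v 10 * w 12)
        + (v 15 * w 11 - v 11 * w 15) + (v 14 * w 13 - v 13 * w 14)
        + (v 17 * w 16 - v 16 * w 17) + (v 20 * w 18 - v 18 * w 20)
        + (v 23 * w 19 - v 19 * w 23) + (v 22 * w 21 - v 21 * w 22)),
       -((v 8 * w 21 - v 21 * w 8) + (v 22 * w 9 - v 9 * w 22)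
        + (v 10 * w 19 - v 19 * w 10) + (v 11 * w 18 - v 18 * w 11)
        + (v 23 * w 12 - v 12 * w 23) + (v 13 * w 16 - v 16 * w 13)
        + (v 17 * w 14 - v 14 * w 17) + (v 20 * w 15 - v 15 * w 20)),
       -((v 12 * w 8 - v 8 * w 12) + (v 10 * w 9 - v 9 * w 10)
        + (v 11 * w 14 - v 14 * w 11) + (v 15 * w 13 - v 13 * w 15)
        + (v 20 * w 16 - v 16 * w 20) + (v 18 * w 17 - v 17 * w 18)
        + (v 19 * w 22 - v 22 * w 19) + (v 23 * w 21 - v 21 * w 23)),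
       -((v 10 * w 8 - v 8 * w 10) + (v 9 * w 12 - v 12 * w 9)
        + (v 13 * w 11 - v 11 * w 13) + (v 15 * w 14 - v 14 * w 15)
        + (v 18 * w 16 - v 16 * w 18) + (v 17 * w 20 - v 20 * w 17)
        + (v 21 * w 19 - v 19 * w 21) + (v 23 * w 22 - v 22 * w 23)),
       -((v 8 * w 16 - v 16 * w 8) + (v 9 * w 17 - v 17 * w 9)
        + (v 10 * w 18 - v 18 * w 10) + (v 11 * w 19 - v 19 * w 11)
        + (v 12 * w 20 - v 20 * w 12) + (v 13 * w 21 - v 21 * w 13)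
        + (v 14 * w 22 - v 22 * w 14) + (v 15 * w 23 - v 23 * w 15))] : Fin 8 → ℝ) ⟨k, h⟩
  else 0
/-- The stratum `n_{-2} = span (X_1, …, X_8)`. -/
def Nm2 : Submodule ℝ Pt where
  carrier := {v | ∀ k : Fin 24, 8 ≤ (k : ℕ) → v k = 0}
  add_mem' := by
    intro a b ha hb
    simp only [Set.mem_setOf_eq] at ha hb ⊢
    intro k hk
    simp [Pi.add_apply, ha k hk, hb k hk]
  zero_mem' := by intro k _; rfl
  smul_mem' := by
    intro c v hv
    simp only [Set.mem_setOf_eq] at hv ⊢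
    intro k hk
    simp [Pi.smul_apply, hv k hk]

/-- The stratum `n_{-1} = span (X_9, …, X_24)`. -/
def Nm1 : Submodule ℝ Pt where
  carrier := {v | ∀ k : Fin 24, (k : ℕ) < 8 → v k = 0}
  add_mem' := by
    intro a b ha hb
    simp only [Set.mem_setOf_eq] at ha hb ⊢
    intro k hk
    simp [Pi.add_apply, ha k hk, hb k hk]
  zero_mem' := by intro k _; rfl
  smul_mem' := by
    intro c v hv
    simp only [Set.mem_setOf_eq] at hv ⊢
    intro k hk
    simp [Pi.smul_apply, hv k hk]

/-- The bracket takes values in `n_{-2}`. -/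
theorem br_mem_Nm2 (v w : Pt) : br v w ∈ Nm2 := by
  intro k hk
  simp [br, Nat.not_lt.mpr hk]

/-- The bracket is linear in its first argument. -/
theorem br_smul_add_left (a : ℝ) (v v' w : Pt) :
    br (a • v + v') w = a • br v w + br v' w := by
  funext k
  by_cases h : (k : ℕ) < 8
  · simp only [br, h, dif_pos, Pi.add_apply, Pi.smul_apply, smul_eq_mul]
    generalize (⟨k, h⟩ : Fin 8) = j
    fin_cases j <;> simp <;> ring
  · simp [br, h]

/-- The bracket is antisymmetric. -/
theorem br_antisymm (v w : Pt) : br v w = -br w v := by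
  funext k
  by_cases h : (k : ℕ) < 8
  · simp only [br, h, dif_pos, Pi.neg_apply]
    generalize (⟨k, h⟩ : Fin 8) = j
    fin_cases j <;> simp <;> ring
  · simp [br, h]

/-- The stratum `n_{-2}` is central. -/
theorem br_eq_zero_of_mem_Nm2 {v : Pt} (hv : v ∈ Nm2) (w : Pt) : br v w = 0 := by
  have hv' : ∀ k : Fin 24, 8 ≤ (k : ℕ) → v k = 0 := hv
  funext k
  by_cases h : (k : ℕ) < 8
  · simp only [br, h, dif_pos, Pi.zero_apply]
    generalize (⟨k, h⟩ : Fin 8) = j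
    fin_cases j <;> simp [hv']
  · simp [br, h]

/-- The bracket with `X_9` maps `n_{-1}` onto `n_{-2}`. -/
theorem exists_br_single_eq {x : Pt} (hx : x ∈ Nm2) :
    ∃ w ∈ Nm1, br (Pi.single 8 1) w = x := by
  have hx' : ∀ k : Fin 24, 8 ≤ (k : ℕ) → x k = 0 := hx
  refine ⟨![0, 0, 0, 0, 0, 0, 0, 0, 0, x 3, x 6, 0, x 5, 0, 0, 0, -x 7, 0, 0, -x 1, 0, -x 4,
    -x 2, -x 0], ?_, ?_⟩
  · change ∀ k : Fin 24, (k : ℕ) < 8 → _ = (0 : ℝ)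
    intro k hk
    fin_cases k <;> first | rfl | simp at hk
  · funext k
    fin_cases k <;> simp [br, hx']

/-- The bracket defined by the E_III structure equations makes `n_{E_III} = n_{-2} ⊕ n_{-1}`
a 2-step nilpotent graded Lie algebra: `n_{-2}` is central, `[n_{-1}, n_{-1}] = n_{-2}`
(so the algebra is fundamental), and `[n, [n, n]] = 0`. -/
theorem nEIII_is_two_step_nilpotent_graded_Lie_algebra :
    -- the bracket is bilinear …
    (∀ (a : ℝ) (v v' w : Pt), br (a • v + v') w = a • br v w + br v' w) ∧
    (∀ (a : ℝ) (v w w' : Pt), br v (a • w + w') = a • br v w + br v w') ∧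
    -- … antisymmetric …
    (∀ v w : Pt, br v w = -br w v) ∧
    -- … and satisfies the Jacobi identity, …
    (∀ v w x : Pt, br (br v w) x + br (br w x) v + br (br x v) w = 0) ∧
    -- … the algebra is the direct sum of the two strata, …
    Nm1 ⊓ Nm2 = ⊥ ∧ Nm1 ⊔ Nm2 = ⊤ ∧
    -- … the stratum n_{-2} is central, …
    (∀ v ∈ Nm2, ∀ w : Pt, br v w = 0) ∧
    -- … [n_{-1}, n_{-1}] = n_{-2} (fundamentality), …
    Submodule.span ℝ {x : Pt | ∃ v ∈ Nm1, ∃ w ∈ Nm1, br v w = x} = Nm2 ∧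
    -- … and the algebra is 2-step nilpotent.
    (∀ u v w : Pt, br u (br v w) = 0) := by
  have hcentral : ∀ u v w : Pt, br (br u v) w = 0 := fun u v w =>
    br_eq_zero_of_mem_Nm2 (br_mem_Nm2 u v) w
  refine ⟨br_smul_add_left, fun a v w w' => ?_, br_antisymm, fun v w x => ?_, ?_, ?_,
    fun v hv w => br_eq_zero_of_mem_Nm2 hv w, le_antisymm ?_ fun x hx => ?_, fun u v w => ?_⟩
  · rw [br_antisymm v, br_smul_add_left, br_antisymm v w, br_antisymm v w', neg_add, smul_neg]
  · simp [hcentral]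
  · rw [eq_bot_iff]
    rintro v ⟨h₁, h₂⟩
    rw [Submodule.mem_bot]
    funext k
    exact (lt_or_ge (k : ℕ) 8).elim (h₁ k) (h₂ k)
  · rw [eq_top_iff]
    rintro v -
    refine Submodule.mem_sup.mpr
      ⟨fun k => if (k : ℕ) < 8 then 0 else v k, fun k hk => if_pos hk,
        fun k => if (k : ℕ) < 8 then v k else 0, fun k hk => if_neg hk.not_gt, ?_⟩
    funext k
    by_cases h : (k : ℕ) < 8 <;> simp [h]
  · rw [Submodule.span_le]
    rintro _ ⟨v, -, w, -, rfl⟩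
    exact br_mem_Nm2 v w
  · obtain ⟨w, hw, h⟩ := exists_br_single_eq hx
    refine Submodule.subset_span ⟨_, fun k hk => ?_, w, hw, h⟩
    exact Pi.single_eq_of_ne (by rintro rfl; simp at hk) _
  · rw [br_antisymm, hcentral, neg_zero]
end
end
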